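/- There exists a unique bilinear form ( , ) : U^{≤0}_{r,s} × U^{≥0}_{r,s} → ℚ(r,s) such that for all x, x' ∈ U^{≥0}_{r,s}, y, y' ∈ U^{≤0}_{r,s}, μ, ν ∈ Q, and i, j ∈ I: (y, x x') = (Δ(y), x' ⊗ x) and (y y', x) = (y ⊗ y', Δ(x)) (where the pairing of tensors is ((y₁⊗y₂),(x₁⊗x₂)) = (y₁,x₁)(y₂,x₂)), (f_i, e_j) = δ_{ij}/(s_i − r_i), (ω'_μ, ω_ν) = r^{⟨μ,ν⟩} s^{−⟨ν,μ⟩}, (ω'_μ, e_i) = 0, and (f_i, ω_μ) = 0. -/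

import Mathlib

noncomputable section

/-- The q-integer `(m)_v = 1 + v + ⋯ + v^{m-1}`. -/
def qnat {K : Type} [CommRing K] (v : K) (m : ℕ) : K := ∑ i ∈ Finset.range m, v ^ i

/-- The Gaussian binomial coefficient `binom(m,k)_v`, as a polynomial expression in `v`
(defined through the Pascal-type recurrence). -/
def qbinom {K : Type} [CommRing K] (v : K) : ℕ → ℕ → K
  | _, 0 => 1
  | 0, _ + 1 => 0
  | m + 1, k + 1 => qbinom v m k + v ^ (k + 1) * qbinom v m (k + 1)

/-- The Euler (Ringel) form on basis elements: `⟨α_i, α_j⟩ = d_i a_{ij}` if `i < j`,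
`d_i` if `i = j`, and `0` if `i > j`. -/
def eulB {n : ℕ} (a : Fin n → Fin n → ℤ) (d : Fin n → ℤ) (i j : Fin n) : ℤ :=
  if i < j then d i * a i j else if i = j then d i else 0

/-- The Euler form on the root lattice `Q = Fin n → ℤ` (coordinates in the basis `α_i`). -/
def euler {n : ℕ} (a : Fin n → Fin n → ℤ) (d : Fin n → ℤ) (μ ν : Fin n → ℤ) : ℤ :=
  ∑ i, ∑ j, μ i * ν j * eulB a d i j

/-- The coefficient `c^{(k)}_{ij} = (r_i s_i⁻¹)^{k(k-1)/2} r^{k⟨α_j,α_i⟩} s^{-k⟨α_i,α_j⟩}`. -/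
def ccoef {K : Type} [Field K] {n : ℕ} (a : Fin n → Fin n → ℤ) (d : Fin n → ℤ)
    (r s : K) (i j : Fin n) (k : ℕ) : K :=
  (r ^ d i * (s ^ d i)⁻¹) ^ (k * (k - 1) / 2) *
    r ^ ((k : ℤ) * eulB a d j i) * (s ^ ((k : ℤ) * eulB a d i j))⁻¹

/-- The `(r,s)`-Serre element
`∑_{k=0}^{1-a_{ij}} (-1)^k binom(1-a_{ij},k)_{r_i s_i⁻¹} c^{(k)}_{ij} E_i^{1-a_{ij}-k} E_j E_i^k`. -/
def serreElt {K : Type} [Field K] {n : ℕ} (a : Fin n → Fin n → ℤ) (d : Fin n → ℤ)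
    (r s : K) {A : Type} [Ring A] [Algebra K A] (E : Fin n → A) (i j : Fin n) : A :=
  ∑ k ∈ Finset.range ((1 - a i j).toNat + 1),
    ((-1 : K) ^ k * qbinom (r ^ d i * (s ^ d i)⁻¹) ((1 - a i j).toNat) k *
        ccoef a d r s i j k) •
      (E i ^ ((1 - a i j).toNat - k) * E j * E i ^ k)

/-- The defining relations of `U⁺_{r,s}`: the `(r,s)`-Serre relations. -/
inductive SerreRel (K : Type) [Field K] {n : ℕ} (a : Fin n → Fin n → ℤ) (d : Fin n → ℤ)
    (r s : K) : FreeAlgebra K (Fin n) → FreeAlgebra K (Fin n) → Prop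
  | rel (i j : Fin n) (h : i ≠ j) :
      SerreRel K a d r s (serreElt a d r s (FreeAlgebra.ι K) i j) 0

/-- `U⁺_{r,s}`: the algebra generated by the `e_i` subject only to the `(r,s)`-Serre
relations. -/
abbrev Uplus (K : Type) [Field K] {n : ℕ} (a : Fin n → Fin n → ℤ) (d : Fin n → ℤ)
    (r s : K) : Type := RingQuot (SerreRel K a d r s)

/-- The generator `e_i` of `U⁺_{r,s}`. -/
def eP (K : Type) [Field K] {n : ℕ} (a : Fin n → Fin n → ℤ) (d : Fin n → ℤ)
    (r s : K) (i : Fin n) : Uplus K a d r s :=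
  RingQuot.mkAlgHom K (SerreRel K a d r s) (FreeAlgebra.ι K i)

/-- The degree-`μ` homogeneous component of `U⁺_{r,s}` for `μ ∈ Q⁺`: the span of the
monomials in the `e_i` in which `e_i` occurs exactly `μ i` times. -/
def UplusDeg (K : Type) [Field K] {n : ℕ} (a : Fin n → Fin n → ℤ) (d : Fin n → ℤ)
    (r s : K) (μ : Fin n → ℕ) : Submodule K (Uplus K a d r s) :=
  Submodule.span K
    {x | ∃ w : List (Fin n), (∀ i, w.count i = μ i) ∧ x = (w.map (eP K a d r s)).prod}


/-- The `(r,s)`-Serre element for the negative generators: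
`∑_{k=0}^{1-a_{ij}} (-1)^k binom(1-a_{ij},k)_{r_i s_i⁻¹} c^{(k)}_{ij} F_i^k F_j F_i^{1-a_{ij}-k}`. -/
def serreEltF {K : Type} [Field K] {n : ℕ} (a : Fin n → Fin n → ℤ) (d : Fin n → ℤ)
    (r s : K) {A : Type} [Ring A] [Algebra K A] (F : Fin n → A) (i j : Fin n) : A :=
  ∑ k ∈ Finset.range ((1 - a i j).toNat + 1),
    ((-1 : K) ^ k * qbinom (r ^ d i * (s ^ d i)⁻¹) ((1 - a i j).toNat) k *
        ccoef a d r s i j k) •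
      (F i ^ k * F j * F i ^ ((1 - a i j).toNat - k))

/-- The field `ℚ(r,s)` of rational functions in two variables over `ℚ`. -/
abbrev K2 : Type := FractionRing (MvPolynomial (Fin 2) ℚ)

/-- The parameter `r ∈ ℚ(r,s)`. -/
def rr : K2 := algebraMap (MvPolynomial (Fin 2) ℚ) K2 (MvPolynomial.X 0)

/-- The parameter `s ∈ ℚ(r,s)`. -/
def ss : K2 := algebraMap (MvPolynomial (Fin 2) ℚ) K2 (MvPolynomial.X 1)

/-- Generators of the two-parameter quantum group `U_{r,s}(𝔤)`:
`e_i, f_i, ω_i^{±1}, ω_i'^{±1}`. -/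
inductive Gen (n : ℕ) : Type
  | e (i : Fin n) : Gen n
  | f (i : Fin n) : Gen n
  | w (i : Fin n) : Gen n
  | winv (i : Fin n) : Gen n
  | w' (i : Fin n) : Gen n
  | w'inv (i : Fin n) : Gen n

/-- The four toral generators `ω_i, ω_i^{-1}, ω_i', ω_i'^{-1}` attached to `i`. -/
def tor {n : ℕ} (i : Fin n) : Bool → Bool → Gen n
  | false, false => Gen.w i
  | false, true => Gen.winv i
  | true, false => Gen.w' i
  | true, true => Gen.w'inv i

/-- The defining relations (R1)–(R6) of the two-parameter quantum group `U_{r,s}(𝔤)`. -/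
inductive URel {n : ℕ} (a : Fin n → Fin n → ℤ) (d : Fin n → ℤ) :
    FreeAlgebra K2 (Gen n) → FreeAlgebra K2 (Gen n) → Prop
  | torComm (i j : Fin n) (p q p' q' : Bool) :
      URel a d (FreeAlgebra.ι K2 (tor i p q) * FreeAlgebra.ι K2 (tor j p' q'))
        (FreeAlgebra.ι K2 (tor j p' q') * FreeAlgebra.ι K2 (tor i p q))
  | wInvR (i : Fin n) :
      URel a d (FreeAlgebra.ι K2 (Gen.w i) * FreeAlgebra.ι K2 (Gen.winv i)) 1
  | wInvL (i : Fin n) :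
      URel a d (FreeAlgebra.ι K2 (Gen.winv i) * FreeAlgebra.ι K2 (Gen.w i)) 1
  | w'InvR (i : Fin n) :
      URel a d (FreeAlgebra.ι K2 (Gen.w' i) * FreeAlgebra.ι K2 (Gen.w'inv i)) 1
  | w'InvL (i : Fin n) :
      URel a d (FreeAlgebra.ι K2 (Gen.w'inv i) * FreeAlgebra.ι K2 (Gen.w' i)) 1
  | we (i j : Fin n) :
      URel a d (FreeAlgebra.ι K2 (Gen.w i) * FreeAlgebra.ι K2 (Gen.e j))
        ((rr ^ eulB a d j i * (ss ^ eulB a d i j)⁻¹) •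
          (FreeAlgebra.ι K2 (Gen.e j) * FreeAlgebra.ι K2 (Gen.w i)))
  | w'e (i j : Fin n) :
      URel a d (FreeAlgebra.ι K2 (Gen.w' i) * FreeAlgebra.ι K2 (Gen.e j))
        (((rr ^ eulB a d i j)⁻¹ * ss ^ eulB a d j i) •
          (FreeAlgebra.ι K2 (Gen.e j) * FreeAlgebra.ι K2 (Gen.w' i)))
  | wf (i j : Fin n) :
      URel a d (FreeAlgebra.ι K2 (Gen.w i) * FreeAlgebra.ι K2 (Gen.f j))
        (((rr ^ eulB a d j i)⁻¹ * ss ^ eulB a d i j) •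
          (FreeAlgebra.ι K2 (Gen.f j) * FreeAlgebra.ι K2 (Gen.w i)))
  | w'f (i j : Fin n) :
      URel a d (FreeAlgebra.ι K2 (Gen.w' i) * FreeAlgebra.ι K2 (Gen.f j))
        ((rr ^ eulB a d i j * (ss ^ eulB a d j i)⁻¹) •
          (FreeAlgebra.ι K2 (Gen.f j) * FreeAlgebra.ι K2 (Gen.w' i)))
  | ef (i j : Fin n) :
      URel a d
        (FreeAlgebra.ι K2 (Gen.e i) * FreeAlgebra.ι K2 (Gen.f j) -
          FreeAlgebra.ι K2 (Gen.f j) * FreeAlgebra.ι K2 (Gen.e i))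
        (if i = j then
          ((rr ^ d i - ss ^ d i)⁻¹) •
            (FreeAlgebra.ι K2 (Gen.w i) - FreeAlgebra.ι K2 (Gen.w' i))
         else 0)
  | serreE (i j : Fin n) (h : i ≠ j) :
      URel a d (serreElt a d rr ss (fun k => FreeAlgebra.ι K2 (Gen.e k)) i j) 0
  | serreF (i j : Fin n) (h : i ≠ j) :
      URel a d (serreEltF a d rr ss (fun k => FreeAlgebra.ι K2 (Gen.f k)) i j) 0

/-- The two-parameter quantum group `U_{r,s}(𝔤)` over `ℚ(r,s)`. -/
abbrev Uq {n : ℕ} (a : Fin n → Fin n → ℤ) (d : Fin n → ℤ) : Type :=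
  RingQuot (URel a d)

/-- The image of a generator in `U_{r,s}(𝔤)`. -/
def gU {n : ℕ} (a : Fin n → Fin n → ℤ) (d : Fin n → ℤ) (x : Gen n) : Uq a d :=
  RingQuot.mkAlgHom K2 (URel a d) (FreeAlgebra.ι K2 x)

/-- The subalgebra `U⁺` of `U_{r,s}(𝔤)` generated by the `e_i`. -/
def Upos {n : ℕ} (a : Fin n → Fin n → ℤ) (d : Fin n → ℤ) : Subalgebra K2 (Uq a d) :=
  Algebra.adjoin K2 (Set.range fun i => gU a d (Gen.e i))

/-- The subalgebra `U⁻` of `U_{r,s}(𝔤)` generated by the `f_i`. -/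
def Uneg {n : ℕ} (a : Fin n → Fin n → ℤ) (d : Fin n → ℤ) : Subalgebra K2 (Uq a d) :=
  Algebra.adjoin K2 (Set.range fun i => gU a d (Gen.f i))

/-- The subalgebra `U⁰` of `U_{r,s}(𝔤)` generated by the `ω_i^{±1}, ω_i'^{±1}`. -/
def Uzero {n : ℕ} (a : Fin n → Fin n → ℤ) (d : Fin n → ℤ) : Subalgebra K2 (Uq a d) :=
  Algebra.adjoin K2 (Set.range fun p : Fin n × Bool × Bool => gU a d (tor p.1 p.2.1 p.2.2))

/-- The generator `e_i` of `U⁺ ⊆ U_{r,s}(𝔤)`, as an element of the subalgebra `U⁺`. -/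
def eUp {n : ℕ} (a : Fin n → Fin n → ℤ) (d : Fin n → ℤ) (i : Fin n) : ↥(Upos a d) :=
  ⟨gU a d (Gen.e i), Algebra.subset_adjoin (Set.mem_range_self i)⟩

open TensorProduct

/-- Generators `e_i, ω_i^{±1}` of the Borel subalgebra `U^{≥0}_{r,s}`. -/
inductive GenP (n : ℕ) : Type
  | e (i : Fin n) : GenP n
  | w (i : Fin n) : GenP n
  | winv (i : Fin n) : GenP n

/-- Generators `f_i, ω_i'^{±1}` of the Borel subalgebra `U^{≤0}_{r,s}`. -/
inductive GenM (n : ℕ) : Type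
  | f (i : Fin n) : GenM n
  | w' (i : Fin n) : GenM n
  | w'inv (i : Fin n) : GenM n

/-- The toral generators `ω_i^{±1}` of `U^{≥0}_{r,s}`. -/
def torP {n : ℕ} (i : Fin n) : Bool → GenP n
  | false => GenP.w i
  | true => GenP.winv i

/-- The toral generators `ω_i'^{±1}` of `U^{≤0}_{r,s}`. -/
def torM {n : ℕ} (i : Fin n) : Bool → GenM n
  | false => GenM.w' i
  | true => GenM.w'inv i

/-- The defining relations of `U^{≥0}_{r,s}`. -/
inductive PRel {n : ℕ} (a : Fin n → Fin n → ℤ) (d : Fin n → ℤ) :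
    FreeAlgebra K2 (GenP n) → FreeAlgebra K2 (GenP n) → Prop
  | torComm (i j : Fin n) (p q : Bool) :
      PRel a d (FreeAlgebra.ι K2 (torP i p) * FreeAlgebra.ι K2 (torP j q))
        (FreeAlgebra.ι K2 (torP j q) * FreeAlgebra.ι K2 (torP i p))
  | wInvR (i : Fin n) :
      PRel a d (FreeAlgebra.ι K2 (GenP.w i) * FreeAlgebra.ι K2 (GenP.winv i)) 1
  | wInvL (i : Fin n) :
      PRel a d (FreeAlgebra.ι K2 (GenP.winv i) * FreeAlgebra.ι K2 (GenP.w i)) 1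
  | we (i j : Fin n) :
      PRel a d (FreeAlgebra.ι K2 (GenP.w i) * FreeAlgebra.ι K2 (GenP.e j))
        ((rr ^ eulB a d j i * (ss ^ eulB a d i j)⁻¹) •
          (FreeAlgebra.ι K2 (GenP.e j) * FreeAlgebra.ι K2 (GenP.w i)))
  | serreE (i j : Fin n) (h : i ≠ j) :
      PRel a d (serreElt a d rr ss (fun k => FreeAlgebra.ι K2 (GenP.e k)) i j) 0

/-- The defining relations of `U^{≤0}_{r,s}`. -/
inductive MRel {n : ℕ} (a : Fin n → Fin n → ℤ) (d : Fin n → ℤ) :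
    FreeAlgebra K2 (GenM n) → FreeAlgebra K2 (GenM n) → Prop
  | torComm (i j : Fin n) (p q : Bool) :
      MRel a d (FreeAlgebra.ι K2 (torM i p) * FreeAlgebra.ι K2 (torM j q))
        (FreeAlgebra.ι K2 (torM j q) * FreeAlgebra.ι K2 (torM i p))
  | w'InvR (i : Fin n) :
      MRel a d (FreeAlgebra.ι K2 (GenM.w' i) * FreeAlgebra.ι K2 (GenM.w'inv i)) 1
  | w'InvL (i : Fin n) :
      MRel a d (FreeAlgebra.ι K2 (GenM.w'inv i) * FreeAlgebra.ι K2 (GenM.w' i)) 1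
  | w'f (i j : Fin n) :
      MRel a d (FreeAlgebra.ι K2 (GenM.w' i) * FreeAlgebra.ι K2 (GenM.f j))
        ((rr ^ eulB a d i j * (ss ^ eulB a d j i)⁻¹) •
          (FreeAlgebra.ι K2 (GenM.f j) * FreeAlgebra.ι K2 (GenM.w' i)))
  | serreF (i j : Fin n) (h : i ≠ j) :
      MRel a d (serreEltF a d rr ss (fun k => FreeAlgebra.ι K2 (GenM.f k)) i j) 0

/-- The Borel subalgebra `U^{≥0}_{r,s}`. -/
abbrev Ugeq {n : ℕ} (a : Fin n → Fin n → ℤ) (d : Fin n → ℤ) : Type := RingQuot (PRel a d)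

/-- The Borel subalgebra `U^{≤0}_{r,s}`. -/
abbrev Uleq {n : ℕ} (a : Fin n → Fin n → ℤ) (d : Fin n → ℤ) : Type := RingQuot (MRel a d)

/-- The image of a generator in `U^{≥0}_{r,s}`. -/
def gP {n : ℕ} (a : Fin n → Fin n → ℤ) (d : Fin n → ℤ) (x : GenP n) : Ugeq a d :=
  RingQuot.mkAlgHom K2 (PRel a d) (FreeAlgebra.ι K2 x)

/-- The image of a generator in `U^{≤0}_{r,s}`. -/
def gM {n : ℕ} (a : Fin n → Fin n → ℤ) (d : Fin n → ℤ) (x : GenM n) : Uleq a d :=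
  RingQuot.mkAlgHom K2 (MRel a d) (FreeAlgebra.ι K2 x)

/-- `ω_μ = ∏_i ω_i^{μ_i}` for `μ ∈ Q`. -/
def wPow {n : ℕ} (a : Fin n → Fin n → ℤ) (d : Fin n → ℤ) (μ : Fin n → ℤ) : Ugeq a d :=
  ((List.finRange n).map fun i => if 0 ≤ μ i then gP a d (GenP.w i) ^ (μ i).toNat
    else gP a d (GenP.winv i) ^ (-μ i).toNat).prod

/-- `ω'_μ = ∏_i ω_i'^{μ_i}` for `μ ∈ Q`. -/
def w'Pow {n : ℕ} (a : Fin n → Fin n → ℤ) (d : Fin n → ℤ) (μ : Fin n → ℤ) : Uleq a d :=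
  ((List.finRange n).map fun i => if 0 ≤ μ i then gM a d (GenM.w' i) ^ (μ i).toNat
    else gM a d (GenM.w'inv i) ^ (-μ i).toNat).prod

/-- The extension of a pairing `B : M × N → ℚ(r,s)` to tensor squares:
`(y₁ ⊗ y₂, x₁ ⊗ x₂) = B(y₁,x₁) B(y₂,x₂)`. -/
def pairT {M N : Type} [AddCommGroup M] [AddCommGroup N] [Module K2 M] [Module K2 N]
    (B : M →ₗ[K2] N →ₗ[K2] K2) : (M ⊗[K2] M) →ₗ[K2] (N ⊗[K2] N) →ₗ[K2] K2 :=
  (TensorProduct.dualDistrib K2 N N).comp (TensorProduct.map B B)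

theorem qbinom_zero_right {K : Type} [CommRing K] (v : K) (m : ℕ) : qbinom v m 0 = 1 := by
  cases m <;> rfl

theorem qbinom_succ_succ {K : Type} [CommRing K] (v : K) (m k : ℕ) :
    qbinom v (m + 1) (k + 1) = qbinom v m k + v ^ (k + 1) * qbinom v m (k + 1) := rfl

theorem qbinom_eq_zero {K : Type} [CommRing K] (v : K) {m k : ℕ} (h : m < k) :
    qbinom v m k = 0 := by
  induction m generalizing k with
  | zero => cases k with
    | zero => omega
    | succ k => rfl
  | succ m ih => cases k with
    | zero => omega
    | succ k => rw [qbinom_succ_succ, ih (by omega), ih (by omega)]; ring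

theorem qbinom_self {K : Type} [CommRing K] (v : K) (m : ℕ) : qbinom v m m = 1 := by
  induction m with
  | zero => rfl
  | succ m ih => rw [qbinom_succ_succ, ih, qbinom_eq_zero v (Nat.lt_succ_self m)]; ring

theorem one_sub_pow_mul_qbinom {K : Type} [CommRing K] (v : K) (k l : ℕ) :
    (1 - v ^ l) * qbinom v (k + l) k = (1 - v ^ (k + 1)) * qbinom v (k + l) (k + 1) := by
  obtain ⟨m, hm⟩ : ∃ m, m = k + l := ⟨_, rfl⟩
  rw [← hm]
  induction m generalizing k l with
  | zero =>
    obtain ⟨rfl, rfl⟩ : k = 0 ∧ l = 0 := by omega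
    rw [qbinom_eq_zero v (Nat.lt_succ_self 0)]; simp
  | succ m ih =>
    cases l with
    | zero => rw [qbinom_eq_zero v (by omega : m + 1 < k + 1)]; simp
    | succ l =>
      have h2 := ih k l (by omega)
      cases k with
      | zero =>
        rw [qbinom_zero_right] at *
        rw [qbinom_succ_succ, qbinom_zero_right]
        linear_combination v * h2
      | succ k =>
        have h1 := ih k (l + 1) (by omega)
        rw [qbinom_succ_succ, qbinom_succ_succ]
        linear_combination h1 + v ^ (k + 2) * h2

/-- The second Pascal-type recurrence of the Gaussian binomial coefficients. -/
theorem qbinom_succ_succ' {K : Type} [CommRing K] (v : K) (k l : ℕ) :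
    qbinom v (k + l + 1) (k + 1) =
      v ^ l * qbinom v (k + l) k + qbinom v (k + l) (k + 1) := by
  rw [qbinom_succ_succ]
  linear_combination one_sub_pow_mul_qbinom v k l

section QuantumAdjoint

variable {K : Type} [Field K] {T : Type} [Ring T] [Algebra K T]

/-- The iterated `q`-commutators `u₀ = z`, `u_{m+1} = x u_m - q v^m u_m x`. -/
def adIter (v q : K) (x z : T) : ℕ → T
  | 0 => z
  | m + 1 => x * adIter v q x z m - (q * v ^ m) • (adIter v q x z m * x)

theorem adIter_succ (v q : K) (x z : T) (m : ℕ) : adIter v q x z (m + 1) =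
    x * adIter v q x z m - (q * v ^ m) • (adIter v q x z m * x) := rfl

theorem adIter_eq_sum (v q : K) (x z : T) (m : ℕ) : adIter v q x z m =
    ∑ p ∈ Finset.HasAntidiagonal.antidiagonal m, ((-1 : K) ^ p.1 * qbinom v m p.1 *
      (v ^ (p.1 * (p.1 - 1) / 2) * q ^ p.1)) • (x ^ p.2 * z * x ^ p.1) := by
  induction m with
  | zero => simp [adIter, qbinom]
  | succ m ih =>
    set g : ℕ → ℕ → T := fun k l => ((-1 : K) ^ k * qbinom v (k + l) k *
      (v ^ (k * (k - 1) / 2) * q ^ k)) • (x ^ l * z * x ^ k) with hg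
    have hsum : ∀ N, ∑ p ∈ Finset.HasAntidiagonal.antidiagonal N, ((-1 : K) ^ p.1 * qbinom v N p.1 *
        (v ^ (p.1 * (p.1 - 1) / 2) * q ^ p.1)) • (x ^ p.2 * z * x ^ p.1) =
        ∑ p ∈ Finset.HasAntidiagonal.antidiagonal N, g p.1 p.2 := by
      intro N
      refine Finset.sum_congr rfl fun p hp => ?_
      rw [Finset.HasAntidiagonal.mem_antidiagonal] at hp
      simp only [hg, hp]
    rw [hsum] at ih ⊢
    have hl : ∀ k l, x * g k l = ((-1 : K) ^ k * qbinom v (k + l) k *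
      (v ^ (k * (k - 1) / 2) * q ^ k)) • (x ^ (l + 1) * z * x ^ k) := by
      intro k l
      simp only [hg, mul_smul_comm, pow_succ', mul_assoc]
    have hr : ∀ k l, g k l * x = ((-1 : K) ^ k * qbinom v (k + l) k *
      (v ^ (k * (k - 1) / 2) * q ^ k)) • (x ^ l * z * x ^ (k + 1)) := by
      intro k l
      simp only [hg, smul_mul_assoc, pow_succ, mul_assoc]
    have htri : ∀ k, (k + 1) * (k + 1 - 1) / 2 = k * (k - 1) / 2 + k := by
      intro k
      rw [← Finset.sum_range_id_mul_two, ← Finset.sum_range_id_mul_two,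
        Finset.sum_range_succ]; omega
    set A : ℕ → ℕ → T := fun k l => match k with
      | 0 => 0
      | k + 1 => -((q * v ^ (k + l)) • (g k l * x)) with hA
    set B : ℕ → ℕ → T := fun k l => match l with
      | 0 => 0
      | l + 1 => x * g k l with hB
    have key : ∀ p ∈ Finset.HasAntidiagonal.antidiagonal (m + 1),
        g p.1 p.2 = A p.1 p.2 + B p.1 p.2 := by
      rintro ⟨k, l⟩ hp
      rw [Finset.HasAntidiagonal.mem_antidiagonal] at hp
      cases k with
      | zero =>
        cases l with
        | zero => simp at hp
        | succ l => simp [hA, hB, hl]; simp [hg, qbinom_zero_right]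
      | succ k =>
        cases l with
        | zero =>
          simp only [hA, hB, hr, smul_smul, ← neg_smul, add_zero]
          simp only [hg, add_zero, qbinom_self, htri]
          congr 1; ring
        | succ l =>
          simp only [hA, hB, hr, hl, smul_smul, ← neg_smul, ← add_smul]
          simp only [hg]
          congr 1
          have := qbinom_succ_succ' v k (l + 1)
          rw [show k + 1 + (l + 1) = k + (l + 1) + 1 by ring, this, htri,
            show k + 1 + l = k + (l + 1) by ring]
          ring
    rw [Finset.sum_congr rfl key, Finset.sum_add_distrib, Finset.Nat.sum_antidiagonal_succ,
      Finset.Nat.sum_antidiagonal_succ', adIter_succ, ih]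
    simp only [hA, hB, Finset.mul_sum, Finset.sum_mul, Finset.smul_sum, Finset.sum_neg_distrib,
      zero_add]
    rw [sub_eq_neg_add]
    congr 2
    refine Finset.sum_congr rfl fun p hp => ?_
    rw [Finset.HasAntidiagonal.mem_antidiagonal] at hp
    rw [hp]

theorem mul_pow_of_qcomm {v : K} {x x' : T} (h : x' * x = v • (x * x')) (k : ℕ) :
    x' * x ^ k = v ^ k • (x ^ k * x') := by
  induction k with
  | zero => simp
  | succ k ih =>
    rw [pow_succ, ← mul_assoc, ih, smul_mul_assoc, mul_assoc, h, mul_smul_comm, smul_smul,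
      pow_succ, mul_assoc]

theorem mul_adIter_of_qcomm (v q : K) {x x' z : T} (hx : x' * x = v • (x * x'))
    (hz : x' * z = q • (z * x')) (m : ℕ) :
    x' * adIter v q x z m = (q * v ^ m) • (adIter v q x z m * x') := by
  induction m with
  | zero => simpa [adIter] using hz
  | succ m ih =>
    set u := adIter v q x z m with hu
    have e1 : x' * (x * u) = (q * v ^ (m + 1)) • (x * u * x') := by
      rw [← mul_assoc, hx, smul_mul_assoc, mul_assoc, ih, mul_smul_comm, smul_smul, mul_assoc]
      ring_nf
    have e2 : x' * (u * x) = (q * v ^ (m + 1)) • (u * x * x') := by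
      rw [← mul_assoc, ih, smul_mul_assoc, mul_assoc, hx, mul_smul_comm, smul_smul, ← mul_assoc u]
      congr 1; ring
    rw [adIter_succ, ← hu, mul_sub, mul_smul_comm, e1, e2, sub_mul, smul_mul_assoc, smul_sub,
      smul_comm]

theorem adIter_mul_of_qcomm (v q p : K) {x x' z' : T} (hx : x' * x = v • (x * x'))
    (hz : z' * x = p • (x * z')) (m : ℕ) :
    adIter v q x' z' m * x = (p * v ^ m) • (x * adIter v q x' z' m) := by
  induction m with
  | zero => simpa [adIter] using hz
  | succ m ih =>
    set u := adIter v q x' z' m with hu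
    have e1 : x' * u * x = (p * v ^ (m + 1)) • (x * (x' * u)) := by
      rw [mul_assoc, ih, mul_smul_comm, ← mul_assoc, hx, smul_mul_assoc, smul_smul, mul_assoc x]
      congr 1; ring
    have e2 : u * x' * x = (p * v ^ (m + 1)) • (x * (u * x')) := by
      rw [mul_assoc, hx, mul_smul_comm, ← mul_assoc, ih, smul_mul_assoc, smul_smul, mul_assoc]
      congr 1; ring
    rw [adIter_succ, ← hu, sub_mul, smul_mul_assoc, e1, e2, mul_sub, mul_smul_comm, smul_sub,
      smul_comm]

/-- The coefficients in the expansion of an iterated `q`-commutator of sums. -/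
def adCoeff (v w : K) (k l : ℕ) : K :=
  qbinom v (k + l) k * ∏ t ∈ Finset.range k, (1 - v ^ (l + t) * w)

theorem adCoeff_zero (v w : K) (l : ℕ) : adCoeff v w 0 l = 1 := by
  simp [adCoeff, qbinom_zero_right]

theorem adCoeff_succ_zero (v w : K) (k : ℕ) :
    adCoeff v w (k + 1) 0 = (1 - w * v ^ k) * adCoeff v w k 0 := by
  simp only [adCoeff, add_zero, qbinom_self, Finset.prod_range_succ]
  ring

theorem adCoeff_succ_succ (v w : K) (k l : ℕ) :
    adCoeff v w (k + 1) (l + 1) = v ^ (k + 1) * adCoeff v w (k + 1) l +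
      (1 - w * v ^ (k + 2 * (l + 1))) * adCoeff v w k (l + 1) := by
  have h1 := qbinom_succ_succ v (k + l + 1) k
  have h2 := qbinom_succ_succ' v k (l + 1)
  simp only [adCoeff, show k + 1 + (l + 1) = k + l + 1 + 1 by ring,
    show k + 1 + l = k + l + 1 by ring, show k + (l + 1) = k + l + 1 by ring] at *
  rw [Finset.prod_range_succ, Finset.prod_range_succ']
  have h3 : ∏ t ∈ Finset.range k, (1 - v ^ (l + (t + 1)) * w) =
      ∏ t ∈ Finset.range k, (1 - v ^ (l + 1 + t) * w) :=
    Finset.prod_congr rfl fun t _ => by rw [add_right_comm, add_assoc]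
  rw [h3, add_zero]
  set P := ∏ t ∈ Finset.range k, (1 - v ^ (l + 1 + t) * w)
  linear_combination P * h1 - P * v ^ (l + 1 + k) * w * h2

theorem adIter_add (v q p : K) {x x' z z' : T} (hxx : x' * x = v • (x * x'))
    (hxz : x' * z = q • (z * x')) (hzx : z' * x = p • (x * z')) (m : ℕ) :
    adIter v q (x + x') (z + z') m = adIter v q x z m +
      ∑ a ∈ Finset.HasAntidiagonal.antidiagonal m,
        adCoeff v (q * p) a.1 a.2 • (x ^ a.1 * adIter v q x' z' a.2) := by
  induction m with
  | zero => simp [adIter, adCoeff_zero]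
  | succ m ih =>
    set U := adIter v q x' z' with hU
    set w := q * p with hw
    set A : ℕ → ℕ → T := fun k l => match k with
      | 0 => 0
      | k + 1 => (adCoeff v w k l * (1 - w * v ^ (k + 2 * l))) • (x ^ (k + 1) * U l) with hA
    set B : ℕ → ℕ → T := fun k l => match l with
      | 0 => 0
      | l + 1 => (adCoeff v w k l * v ^ k) • (x ^ k * U (l + 1)) with hB
    have key : ∀ a ∈ Finset.HasAntidiagonal.antidiagonal (m + 1),
        adCoeff v w a.1 a.2 • (x ^ a.1 * U a.2) = A a.1 a.2 + B a.1 a.2 := by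
      rintro ⟨k, l⟩ ha
      rw [Finset.HasAntidiagonal.mem_antidiagonal] at ha
      cases k with
      | zero =>
        cases l with
        | zero => simp at ha
        | succ l => simp [hA, hB, adCoeff_zero]
      | succ k =>
        cases l with
        | zero =>
          simp only [hA, hB, add_zero, adCoeff_succ_zero, mul_zero]
          congr 1; ring
        | succ l =>
          simp only [hA, hB, ← add_smul, adCoeff_succ_succ]
          congr 1; ring
    have step : ∀ k l, (x + x') * (x ^ k * U l) - (q * v ^ (k + l)) • (x ^ k * U l * (x + x')) =
        (1 - w * v ^ (k + 2 * l)) • (x ^ (k + 1) * U l) + v ^ k • (x ^ k * U (l + 1)) := by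
      intro k l
      have e1 : x ^ k * U l * x = (p * v ^ l) • (x ^ (k + 1) * U l) := by
        rw [mul_assoc, adIter_mul_of_qcomm v q p hxx hzx, mul_smul_comm, ← mul_assoc, pow_succ]
      have e2 : x' * (x ^ k * U l) = v ^ k • (x ^ k * (x' * U l)) := by
        rw [← mul_assoc, mul_pow_of_qcomm hxx, smul_mul_assoc, mul_assoc]
      rw [add_mul, mul_add, e1, e2, ← mul_assoc, ← pow_succ', hU, adIter_succ, ← hU]
      simp only [mul_sub, mul_smul_comm, smul_sub, smul_add, smul_smul, sub_smul, one_smul,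
        ← mul_assoc, hw]
      rw [show q * v ^ (k + l) * p * v ^ l = q * p * v ^ (k + 2 * l) by ring,
        show v ^ k * q * v ^ l = q * v ^ (k + l) by ring]
      abel
    have base : (x + x') * adIter v q x z m - (q * v ^ m) • (adIter v q x z m * (x + x')) =
        adIter v q x z (m + 1) := by
      rw [adIter_succ, add_mul, mul_add, mul_adIter_of_qcomm v q hxx hxz, smul_add]
      abel
    rw [Finset.sum_congr rfl key, Finset.sum_add_distrib, Finset.Nat.sum_antidiagonal_succ,
      Finset.Nat.sum_antidiagonal_succ', adIter_succ, ih, mul_add (x + x'),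
      add_mul (adIter v q x z m), smul_add, add_sub_add_comm, base, Finset.mul_sum,
      Finset.sum_mul, Finset.smul_sum,
      ← Finset.sum_sub_distrib]
    simp only [hA, hB, zero_add]
    rw [← Finset.sum_add_distrib]
    congr 1
    refine Finset.sum_congr rfl fun a ha => ?_
    rw [Finset.HasAntidiagonal.mem_antidiagonal] at ha
    rw [mul_smul_comm, smul_mul_assoc, smul_comm, ← smul_sub, ← ha, step, smul_add, smul_smul,
      smul_smul]

/-- At the critical exponent, where `q p v ^ m = 1`, the iterated `q`-commutator is additive. -/
theorem adIter_succ_add_of_critical (v q p : K) {x x' z z' : T} (hxx : x' * x = v • (x * x'))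
    (hxz : x' * z = q • (z * x')) (hzx : z' * x = p • (x * z')) (m : ℕ)
    (hcrit : v ^ m * (q * p) = 1) :
    adIter v q (x + x') (z + z') (m + 1) =
      adIter v q x z (m + 1) + adIter v q x' z' (m + 1) := by
  rw [adIter_add v q p hxx hxz hzx, Finset.Nat.sum_antidiagonal_succ, Finset.sum_eq_zero]
  · simp [adCoeff_zero]
  · intro a ha
    rw [Finset.HasAntidiagonal.mem_antidiagonal] at ha
    have : adCoeff v (q * p) (a.1 + 1) a.2 = 0 := by
      rw [adCoeff, Finset.prod_range_succ, add_comm a.2, ha, hcrit]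
      simp
    rw [this, zero_smul]

end QuantumAdjoint

section Serre

/-- The scalar `r^{⟨α_j,α_i⟩} s^{-⟨α_i,α_j⟩}` by which `ω_i` and `e_j` commute. -/
def qcoef {K : Type} [Field K] {n : ℕ} (a : Fin n → Fin n → ℤ) (d : Fin n → ℤ)
    (r s : K) (i j : Fin n) : K :=
  r ^ eulB a d j i * (s ^ eulB a d i j)⁻¹

variable {K : Type} [Field K] {n : ℕ} {a : Fin n → Fin n → ℤ} {d : Fin n → ℤ} {r s : K}
  {A : Type} [Ring A] [Algebra K A]

theorem qcoef_self (i : Fin n) : qcoef a d r s i i = r ^ d i * (s ^ d i)⁻¹ := by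
  simp [qcoef, eulB]

theorem eulB_add_eulB (hsym : ∀ i j, d i * a i j = d j * a j i) {i j : Fin n} (h : i ≠ j) :
    eulB a d i j + eulB a d j i = d i * a i j := by
  rcases lt_or_gt_of_ne h with h' | h'
  · simp [eulB, h', h'.not_gt, h.symm]
  · simp [eulB, h', h'.not_gt, h, hsym i j]

theorem qcoef_critical (hr : r ≠ 0) (hs : s ≠ 0) (hsym : ∀ i j, d i * a i j = d j * a j i)
    {i j : Fin n} (h : i ≠ j) {m : ℕ} (hm : (m : ℤ) = -a i j) :
    (r ^ d i * (s ^ d i)⁻¹) ^ m * (qcoef a d r s i j * qcoef a d r s j i) = 1 := by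
  have e := eulB_add_eulB hsym h
  have e1 : ∀ t : K, t ≠ 0 → t ^ eulB a d j i * t ^ eulB a d i j * (t ^ d i) ^ m = 1 := by
    intro t ht
    rw [← zpow_add₀ ht, add_comm, e, ← zpow_natCast, ← zpow_mul, ← zpow_add₀ ht, hm]
    ring_nf
    simp
  have hr1 := e1 r hr
  have hs1 := e1 s hs
  calc _ = (r ^ eulB a d j i * r ^ eulB a d i j * (r ^ d i) ^ m) *
      (s ^ eulB a d j i * s ^ eulB a d i j * (s ^ d i) ^ m)⁻¹ := by
        simp only [qcoef, mul_pow, mul_inv, inv_pow]; ring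
    _ = 1 := by rw [hr1, hs1]; simp

theorem ccoef_eq (i j : Fin n) (k : ℕ) : ccoef a d r s i j k =
    (r ^ d i * (s ^ d i)⁻¹) ^ (k * (k - 1) / 2) * qcoef a d r s i j ^ k := by
  have e : ∀ (t : K) (z : ℤ), t ^ ((k : ℤ) * z) = (t ^ z) ^ k := fun t z => by
    rw [mul_comm, zpow_mul, zpow_natCast]
  rw [ccoef, qcoef, e, e, mul_pow (r ^ eulB a d j i), inv_pow, mul_assoc]

theorem serreElt_eq_adIter (E : Fin n → A) (i j : Fin n) : serreElt a d r s E i j =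
    adIter (r ^ d i * (s ^ d i)⁻¹) (qcoef a d r s i j) (E i) (E j) (1 - a i j).toNat := by
  rw [adIter_eq_sum, Finset.Nat.sum_antidiagonal_eq_sum_range_succ_mk]
  simp only [serreElt, ccoef_eq]

theorem serreElt_add (hr : r ≠ 0) (hs : s ≠ 0) (hoff : ∀ i j, i ≠ j → a i j ≤ 0)
    (hsym : ∀ i j, d i * a i j = d j * a j i) {E E' : Fin n → A}
    (hE : ∀ i j, E' i * E j = qcoef a d r s i j • (E j * E' i)) {i j : Fin n} (h : i ≠ j) :
    serreElt a d r s (fun k => E k + E' k) i j =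
      serreElt a d r s E i j + serreElt a d r s E' i j := by
  obtain ⟨m, hm⟩ := Int.eq_ofNat_of_zero_le (neg_nonneg.2 (hoff i j h))
  have hm' : (1 - a i j).toNat = m + 1 := by omega
  simp only [serreElt_eq_adIter, hm']
  refine adIter_succ_add_of_critical _ _ (qcoef a d r s j i) ?_ (hE i j) (hE j i) m
    (qcoef_critical hr hs hsym h hm.symm)
  rw [← qcoef_self]
  exact hE i i

theorem map_serreElt {B : Type} [Ring B] [Algebra K B] (f : A →ₐ[K] B) (E : Fin n → A)
    (i j : Fin n) : f (serreElt a d r s E i j) = serreElt a d r s (fun k => f (E k)) i j := by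
  simp [serreElt, map_sum]

theorem map_serreEltF {B : Type} [Ring B] [Algebra K B] (f : A →ₐ[K] B) (E : Fin n → A)
    (i j : Fin n) : f (serreEltF a d r s E i j) = serreEltF a d r s (fun k => f (E k)) i j := by
  simp [serreEltF, map_sum]

theorem serreElt_mkAlgHom {X : Type} {R : FreeAlgebra K X → FreeAlgebra K X → Prop}
    {g : Fin n → X} {i j : Fin n}
    (h : R (serreElt a d r s (fun k => FreeAlgebra.ι K (g k)) i j) 0) :
    serreElt a d r s (fun k => RingQuot.mkAlgHom K R (FreeAlgebra.ι K (g k))) i j = 0 := by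
  rw [← map_serreElt, RingQuot.mkAlgHom_rel K h, map_zero]

theorem serreEltF_mkAlgHom {X : Type} {R : FreeAlgebra K X → FreeAlgebra K X → Prop}
    {g : Fin n → X} {i j : Fin n}
    (h : R (serreEltF a d r s (fun k => FreeAlgebra.ι K (g k)) i j) 0) :
    serreEltF a d r s (fun k => RingQuot.mkAlgHom K R (FreeAlgebra.ι K (g k))) i j = 0 := by
  rw [← map_serreEltF, RingQuot.mkAlgHom_rel K h, map_zero]

theorem op_serreEltF (F : Fin n → A) (i j : Fin n) : MulOpposite.op (serreEltF a d r s F i j) =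
    serreElt a d r s (fun k => MulOpposite.op (F k)) i j := by
  simp [serreEltF, serreElt, mul_assoc]

theorem serreEltF_add (hr : r ≠ 0) (hs : s ≠ 0) (hoff : ∀ i j, i ≠ j → a i j ≤ 0)
    (hsym : ∀ i j, d i * a i j = d j * a j i) {F F' : Fin n → A}
    (hF : ∀ i j, F' i * F j = qcoef a d r s j i • (F j * F' i)) {i j : Fin n} (h : i ≠ j) :
    serreEltF a d r s (fun k => F k + F' k) i j =
      serreEltF a d r s F i j + serreEltF a d r s F' i j := by
  apply MulOpposite.op_injective
  rw [MulOpposite.op_add, op_serreEltF, op_serreEltF, op_serreEltF, add_comm,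
    ← serreElt_add hr hs hoff hsym _ h]
  · simp only [MulOpposite.op_add, add_comm]
  · intro i j
    rw [← MulOpposite.op_mul, ← MulOpposite.op_mul, hF, MulOpposite.op_smul]

theorem serreElt_eq_zero_of_eq_zero (hoff : ∀ i j, i ≠ j → a i j ≤ 0) {E : Fin n → A}
    {i j : Fin n} (h : i ≠ j) (hE : E i = 0 ∨ E j = 0) : serreElt a d r s E i j = 0 := by
  have hpos : (1 - a i j).toNat ≠ 0 := by have := hoff i j h; omega
  refine Finset.sum_eq_zero fun k _ => ?_
  rcases hE with hE | hE
  · rcases Nat.eq_zero_or_pos k with rfl | hk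
    · simp [hE, hpos]
    · simp [hE, hk.ne']
  · simp [hE]

theorem serreEltF_eq_zero_of_eq_zero (hoff : ∀ i j, i ≠ j → a i j ≤ 0) {F : Fin n → A}
    {i j : Fin n} (h : i ≠ j) (hF : F i = 0 ∨ F j = 0) : serreEltF a d r s F i j = 0 := by
  apply MulOpposite.op_injective
  rw [op_serreEltF, serreElt_eq_zero_of_eq_zero hoff h (by simpa using hF), MulOpposite.op_zero]

theorem serreElt_tmul {B : Type} [Ring B] [Algebra K B] {W : Fin n → A} {E : Fin n → B}
    {i j : Fin n} (hW : W i * W j = W j * W i) :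
    serreElt a d r s (fun k => W k ⊗ₜ[K] E k) i j =
      (W i ^ (1 - a i j).toNat * W j) ⊗ₜ[K] serreElt a d r s E i j := by
  rw [serreElt, serreElt, TensorProduct.tmul_sum]
  refine Finset.sum_congr rfl fun k hk => ?_
  rw [Algebra.TensorProduct.tmul_pow, Algebra.TensorProduct.tmul_pow,
    Algebra.TensorProduct.tmul_mul_tmul, Algebra.TensorProduct.tmul_mul_tmul,
    TensorProduct.tmul_smul, mul_assoc (W i ^ _), ← (Commute.pow_left hW k).eq, ← mul_assoc,
    ← pow_add,
    Nat.sub_add_cancel (Finset.mem_range_succ_iff.1 hk)]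

theorem serreEltF_tmul {B : Type} [Ring B] [Algebra K B] {F : Fin n → A} {W : Fin n → B}
    {i j : Fin n} (hW : W i * W j = W j * W i) :
    serreEltF a d r s (fun k => F k ⊗ₜ[K] W k) i j =
      serreEltF a d r s F i j ⊗ₜ[K] (W i ^ (1 - a i j).toNat * W j) := by
  rw [serreEltF, serreEltF, TensorProduct.sum_tmul]
  refine Finset.sum_congr rfl fun k hk => ?_
  rw [Algebra.TensorProduct.tmul_pow, Algebra.TensorProduct.tmul_pow,
    Algebra.TensorProduct.tmul_mul_tmul, Algebra.TensorProduct.tmul_mul_tmul,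
    ← TensorProduct.smul_tmul', mul_assoc (W i ^ _), ← (Commute.pow_left hW _).eq, ← mul_assoc,
    ← pow_add,
    Nat.add_sub_cancel' (Finset.mem_range_succ_iff.1 hk)]

end Serre

section Borel

variable {n : ℕ} {a : Fin n → Fin n → ℤ} {d : Fin n → ℤ}

theorem rr_ne_zero : rr ≠ 0 := by
  simp [rr]

theorem ss_ne_zero : ss ≠ 0 := by
  simp [ss]

theorem qcoef_ne_zero (i j : Fin n) : qcoef a d rr ss i j ≠ 0 :=
  mul_ne_zero (zpow_ne_zero _ rr_ne_zero) (inv_ne_zero (zpow_ne_zero _ ss_ne_zero))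

variable (a d) in
/-- Elements `E i`, `W i`, `V i` of an algebra satisfying the relations of the generators
`e_i`, `ω_i`, `ω_i⁻¹` of `U^{≥0}_{r,s}`. -/
structure IsPosRep {B : Type} [Ring B] [Algebra K2 B] (E W V : Fin n → B) : Prop where
  comm : ∀ i j, W i * W j = W j * W i
  mul_inv : ∀ i, W i * V i = 1
  inv_mul : ∀ i, V i * W i = 1
  qcomm : ∀ i j, W i * E j = qcoef a d rr ss i j • (E j * W i)
  serre : ∀ i j, i ≠ j → serreElt a d rr ss E i j = 0

variable (a d) in
/-- Elements `F i`, `W i`, `V i` of an algebra satisfying the relations of the generators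
`f_i`, `ω'_i`, `ω'_i⁻¹` of `U^{≤0}_{r,s}`. -/
structure IsNegRep {B : Type} [Ring B] [Algebra K2 B] (F W V : Fin n → B) : Prop where
  comm : ∀ i j, W i * W j = W j * W i
  mul_inv : ∀ i, W i * V i = 1
  inv_mul : ∀ i, V i * W i = 1
  qcomm : ∀ i j, W i * F j = qcoef a d rr ss j i • (F j * W i)
  serre : ∀ i j, i ≠ j → serreEltF a d rr ss F i j = 0

theorem isPosRep_gP : IsPosRep a d (fun i => gP a d (GenP.e i)) (fun i => gP a d (GenP.w i))
    (fun i => gP a d (GenP.winv i)) where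
  comm i j := by
    simpa [gP, torP] using
      RingQuot.mkAlgHom_rel K2 (PRel.torComm (a := a) (d := d) i j false false)
  mul_inv i := by simpa [gP] using RingQuot.mkAlgHom_rel K2 (PRel.wInvR (a := a) (d := d) i)
  inv_mul i := by simpa [gP] using RingQuot.mkAlgHom_rel K2 (PRel.wInvL (a := a) (d := d) i)
  qcomm i j := by
    simpa [gP, qcoef] using RingQuot.mkAlgHom_rel K2 (PRel.we (a := a) (d := d) i j)
  serre i j h := serreElt_mkAlgHom (PRel.serreE (a := a) (d := d) i j h)

theorem isNegRep_gM : IsNegRep a d (fun i => gM a d (GenM.f i)) (fun i => gM a d (GenM.w' i))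
    (fun i => gM a d (GenM.w'inv i)) where
  comm i j := by
    simpa [gM, torM] using
      RingQuot.mkAlgHom_rel K2 (MRel.torComm (a := a) (d := d) i j false false)
  mul_inv i := by simpa [gM] using RingQuot.mkAlgHom_rel K2 (MRel.w'InvR (a := a) (d := d) i)
  inv_mul i := by simpa [gM] using RingQuot.mkAlgHom_rel K2 (MRel.w'InvL (a := a) (d := d) i)
  qcomm i j := by
    simpa [gM, qcoef] using RingQuot.mkAlgHom_rel K2 (MRel.w'f (a := a) (d := d) i j)
  serre i j h := serreEltF_mkAlgHom (MRel.serreF (a := a) (d := d) i j h)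

theorem commute_of_isInv {B ι : Type} [Ring B] {W V : ι → B}
    (hc : ∀ i j, W i * W j = W j * W i) (hwv : ∀ i, W i * V i = 1) (hvw : ∀ i, V i * W i = 1)
    (i j : ι) : Commute (W i) (V j) ∧ Commute (V i) (V j) := by
  have h : ∀ i j, Commute (W i) (V j) := fun i j => by
    let u : Bˣ := ⟨W j, V j, hwv j, hvw j⟩
    exact Commute.units_inv_right (u := u) (hc i j)
  let u : Bˣ := ⟨W i, V i, hwv i, hvw i⟩
  exact ⟨h i j, Commute.units_inv_left (u := u) (h i j)⟩

theorem exists_liftP {B : Type} [Ring B] [Algebra K2 B] {E W V : Fin n → B}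
    (h : IsPosRep a d E W V) : ∃ f : Ugeq a d →ₐ[K2] B, (∀ i, f (gP a d (GenP.e i)) = E i) ∧
      (∀ i, f (gP a d (GenP.w i)) = W i) ∧ (∀ i, f (gP a d (GenP.winv i)) = V i) := by
  let g : GenP n → B := fun x => match x with
    | .e i => E i
    | .w i => W i
    | .winv i => V i
  have hg : ∀ ⦃x y⦄, PRel a d x y → FreeAlgebra.lift K2 g x = FreeAlgebra.lift K2 g y := by
    rintro _ _ (⟨i, j, p, q⟩ | i | i | ⟨i, j⟩ | ⟨i, j, hij⟩)
    · have hc := commute_of_isInv h.comm h.mul_inv h.inv_mul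
      cases p <;> cases q
      · simpa [torP, g] using h.comm i j
      · simpa [torP, g] using (hc i j).1.eq
      · simpa [torP, g] using (hc j i).1.eq.symm
      · simpa [torP, g] using (hc i j).2.eq
    · simpa [g] using h.mul_inv i
    · simpa [g] using h.inv_mul i
    · simpa [g, qcoef] using h.qcomm i j
    · simpa [map_serreElt, g] using h.serre i j hij
  refine ⟨RingQuot.liftAlgHom K2 ⟨FreeAlgebra.lift K2 g, hg⟩, ?_, ?_, ?_⟩ <;> intro i <;>
    simp [gP, g]

theorem exists_liftM {B : Type} [Ring B] [Algebra K2 B] {F W V : Fin n → B}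
    (h : IsNegRep a d F W V) : ∃ f : Uleq a d →ₐ[K2] B, (∀ i, f (gM a d (GenM.f i)) = F i) ∧
      (∀ i, f (gM a d (GenM.w' i)) = W i) ∧ (∀ i, f (gM a d (GenM.w'inv i)) = V i) := by
  let g : GenM n → B := fun x => match x with
    | .f i => F i
    | .w' i => W i
    | .w'inv i => V i
  have hg : ∀ ⦃x y⦄, MRel a d x y → FreeAlgebra.lift K2 g x = FreeAlgebra.lift K2 g y := by
    rintro _ _ (⟨i, j, p, q⟩ | i | i | ⟨i, j⟩ | ⟨i, j, hij⟩)
    · have hc := commute_of_isInv h.comm h.mul_inv h.inv_mul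
      cases p <;> cases q
      · simpa [torM, g] using h.comm i j
      · simpa [torM, g] using (hc i j).1.eq
      · simpa [torM, g] using (hc j i).1.eq.symm
      · simpa [torM, g] using (hc i j).2.eq
    · simpa [g] using h.mul_inv i
    · simpa [g] using h.inv_mul i
    · simpa [g, qcoef] using h.qcomm i j
    · simpa [map_serreEltF, g] using h.serre i j hij
  refine ⟨RingQuot.liftAlgHom K2 ⟨FreeAlgebra.lift K2 g, hg⟩, ?_, ?_, ?_⟩ <;> intro i <;>
    simp [gM, g]

theorem Ugeq.induction {P : Ugeq a d → Prop} (one : P 1) (e : ∀ i, P (gP a d (GenP.e i)))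
    (w : ∀ i, P (gP a d (GenP.w i))) (winv : ∀ i, P (gP a d (GenP.winv i)))
    (mul : ∀ x y, P x → P y → P (x * y)) (add : ∀ x y, P x → P y → P (x + y))
    (smul : ∀ (c : K2) x, P x → P (c • x)) (x : Ugeq a d) : P x := by
  obtain ⟨x, rfl⟩ := RingQuot.mkAlgHom_surjective K2 (PRel a d) x
  induction x using FreeAlgebra.induction with
  | grade0 c => rw [AlgHom.commutes, Algebra.algebraMap_eq_smul_one]; exact smul c 1 one
  | grade1 x => exact match x with
    | .e i => e i
    | .w i => w i
    | .winv i => winv i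
  | mul x y hx hy => rw [map_mul]; exact mul _ _ hx hy
  | add x y hx hy => rw [map_add]; exact add _ _ hx hy

theorem Uleq.induction {P : Uleq a d → Prop} (one : P 1) (f : ∀ i, P (gM a d (GenM.f i)))
    (w' : ∀ i, P (gM a d (GenM.w' i))) (w'inv : ∀ i, P (gM a d (GenM.w'inv i)))
    (mul : ∀ x y, P x → P y → P (x * y)) (add : ∀ x y, P x → P y → P (x + y))
    (smul : ∀ (c : K2) x, P x → P (c • x)) (x : Uleq a d) : P x := by
  obtain ⟨x, rfl⟩ := RingQuot.mkAlgHom_surjective K2 (MRel a d) x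
  induction x using FreeAlgebra.induction with
  | grade0 c => rw [AlgHom.commutes, Algebra.algebraMap_eq_smul_one]; exact smul c 1 one
  | grade1 x => exact match x with
    | .f i => f i
    | .w' i => w' i
    | .w'inv i => w'inv i
  | mul x y hx hy => rw [map_mul]; exact mul _ _ hx hy
  | add x y hx hy => rw [map_add]; exact add _ _ hx hy

theorem Ugeq.algHom_ext {B : Type} [Ring B] [Algebra K2 B] {f g : Ugeq a d →ₐ[K2] B}
    (e : ∀ i, f (gP a d (GenP.e i)) = g (gP a d (GenP.e i)))
    (w : ∀ i, f (gP a d (GenP.w i)) = g (gP a d (GenP.w i)))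
    (winv : ∀ i, f (gP a d (GenP.winv i)) = g (gP a d (GenP.winv i))) : f = g := by
  ext x
  cases x
  · exact e _
  · exact w _
  · exact winv _

theorem isPosRep_tmul (hoff : ∀ i j, i ≠ j → a i j ≤ 0)
    (hsym : ∀ i j, d i * a i j = d j * a j i) {B : Type} [Ring B] [Algebra K2 B]
    {E W V : Fin n → B} (h : IsPosRep a d E W V) :
    IsPosRep a d (fun i => E i ⊗ₜ[K2] (1 : B) + W i ⊗ₜ[K2] E i)
      (fun i => W i ⊗ₜ[K2] W i) (fun i => V i ⊗ₜ[K2] V i) where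
  comm i j := by simp [h.comm i j]
  mul_inv i := by simp [h.mul_inv, Algebra.TensorProduct.one_def]
  inv_mul i := by simp [h.inv_mul, Algebra.TensorProduct.one_def]
  qcomm i j := by
    simp [mul_add, add_mul, h.qcomm i j, h.comm i j, TensorProduct.smul_tmul']
  serre i j hij := by
    rw [serreElt_add rr_ne_zero ss_ne_zero hoff hsym _ hij, serreElt_tmul (h.comm i j),
      h.serre i j hij, TensorProduct.tmul_zero, add_zero]
    · have := map_serreElt (a := a) (d := d) (r := rr) (s := ss)
        (Algebra.TensorProduct.includeLeft : B →ₐ[K2] B ⊗[K2] B) E i j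
      rw [h.serre i j hij, map_zero] at this
      exact this.symm
    · intro i j
      simp [h.qcomm i j, TensorProduct.smul_tmul']

theorem serreEltF_coproduct (hoff : ∀ i j, i ≠ j → a i j ≤ 0)
    (hsym : ∀ i j, d i * a i j = d j * a j i) {B : Type} [Ring B] [Algebra K2 B]
    {F W : Fin n → B} (hcomm : ∀ i j, W i * W j = W j * W i)
    (hq : ∀ i j, W i * F j = qcoef a d rr ss j i • (F j * W i)) {i j : Fin n} (hij : i ≠ j) :
    serreEltF a d rr ss (fun i => (1 : B) ⊗ₜ[K2] F i + F i ⊗ₜ[K2] W i) i j =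
      1 ⊗ₜ[K2] serreEltF a d rr ss F i j +
        serreEltF a d rr ss F i j ⊗ₜ[K2] (W i ^ (1 - a i j).toNat * W j) := by
  rw [serreEltF_add rr_ne_zero ss_ne_zero hoff hsym _ hij, serreEltF_tmul (hcomm i j)]
  · congr 1
    exact (map_serreEltF (Algebra.TensorProduct.includeRight : B →ₐ[K2] B ⊗[K2] B) F i j).symm
  · intro i j
    simp [hq i j]

theorem isNegRep_tmul (hoff : ∀ i j, i ≠ j → a i j ≤ 0)
    (hsym : ∀ i j, d i * a i j = d j * a j i) {B : Type} [Ring B] [Algebra K2 B]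
    {F W V : Fin n → B} (h : IsNegRep a d F W V) :
    IsNegRep a d (fun i => (1 : B) ⊗ₜ[K2] F i + F i ⊗ₜ[K2] W i)
      (fun i => W i ⊗ₜ[K2] W i) (fun i => V i ⊗ₜ[K2] V i) where
  comm i j := by simp [h.comm i j]
  mul_inv i := by simp [h.mul_inv, Algebra.TensorProduct.one_def]
  inv_mul i := by simp [h.inv_mul, Algebra.TensorProduct.one_def]
  qcomm i j := by
    simp [mul_add, add_mul, h.qcomm i j, h.comm i j, TensorProduct.smul_tmul']
  serre i j hij := by
    rw [serreEltF_coproduct hoff hsym h.comm h.qcomm hij, h.serre i j hij]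
    simp

end Borel

section ConvolutionDual

variable {K : Type} [Field K] {A : Type} [Ring A] [Algebra K A]

theorem exists_coalgebra_of_algHom (Δ : A →ₐ[K] A ⊗[K] A) (ε : A →ₐ[K] K)
    (h₁ : ((Algebra.TensorProduct.assoc K K K A A A).toAlgHom.comp
      (Algebra.TensorProduct.map Δ (AlgHom.id K A))).comp Δ =
        (Algebra.TensorProduct.map (AlgHom.id K A) Δ).comp Δ)
    (h₂ : (Algebra.TensorProduct.map ε (AlgHom.id K A)).comp Δ =
      Algebra.TensorProduct.includeRight)
    (h₃ : (Algebra.TensorProduct.map (AlgHom.id K A) ε).comp Δ =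
      Algebra.TensorProduct.includeLeft) :
    ∃ C : Coalgebra K A, C.comul = Δ.toLinearMap ∧ C.counit = ε.toLinearMap :=
  ⟨{ comul := Δ.toLinearMap
     counit := ε.toLinearMap
     coassoc := congrArg AlgHom.toLinearMap h₁
     rTensor_counit_comp_comul := congrArg AlgHom.toLinearMap h₂
     lTensor_counit_comp_comul := congrArg AlgHom.toLinearMap h₃ }, rfl, rfl⟩

/-- The dual of a coalgebra as an algebra under convolution. -/
def ConvDual (K A : Type) [Field K] [Ring A] [Algebra K A] : Type := WithConv (A →ₗ[K] K)

namespace ConvDual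

variable [Coalgebra K A]

instance : Ring (ConvDual K A) := inferInstanceAs (Ring (WithConv (A →ₗ[K] K)))

instance : Algebra K (ConvDual K A) := inferInstanceAs (Algebra K (WithConv (A →ₗ[K] K)))

variable (K A) in
/-- The evaluation pairing of the convolution dual with the coalgebra. -/
def eval : ConvDual K A ≃ₗ[K] (A →ₗ[K] K) where
  toFun f := WithConv.ofConv f
  invFun f := WithConv.toConv f
  left_inv _ := rfl
  right_inv _ := rfl
  map_add' _ _ := rfl
  map_smul' _ _ := rfl

theorem eval_mul (f g : ConvDual K A) (x : A) : eval K A (f * g) x =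
    LinearMap.mul' K K (TensorProduct.map (eval K A f) (eval K A g) (Coalgebra.comul x)) := rfl

theorem eval_one (x : A) : eval K A 1 x = Coalgebra.counit (R := K) x := rfl

theorem eval_mul_repr (f g : ConvDual K A) {x : A} {ι : Type} (X : Coalgebra.Repr K x ι) :
    eval K A (f * g) x = ∑ i ∈ X.index, eval K A f (X.left i) * eval K A g (X.right i) := by
  simp [eval_mul, ← X.eq]

variable (K A) in
/-- The evaluation pairing on tensor squares. -/
def pair : (ConvDual K A ⊗[K] ConvDual K A) →ₗ[K] (A ⊗[K] A) →ₗ[K] K :=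
  (TensorProduct.dualDistrib K A A).comp
    (TensorProduct.map (eval K A).toLinearMap (eval K A).toLinearMap)

@[simp]
theorem pair_tmul (f g : ConvDual K A) (x y : A) :
    pair K A (f ⊗ₜ g) (x ⊗ₜ y) = eval K A f x * eval K A g y := by
  simp [pair]

theorem pair_mul (t t' : ConvDual K A ⊗[K] ConvDual K A) {x y : A} {ι κ : Type}
    (X : Coalgebra.Repr K x ι) (Y : Coalgebra.Repr K y κ) :
    pair K A (t * t') (x ⊗ₜ y) = ∑ i ∈ X.index, ∑ j ∈ Y.index,
      pair K A t (X.left i ⊗ₜ Y.left j) * pair K A t' (X.right i ⊗ₜ Y.right j) := by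
  induction t with
  | zero => simp
  | add t₁ t₂ h₁ h₂ => simp only [add_mul, map_add, LinearMap.add_apply, h₁, h₂,
      Finset.sum_add_distrib]
  | tmul f g =>
    induction t' with
    | zero => simp
    | add t₁ t₂ h₁ h₂ => simp only [mul_add, map_add, LinearMap.add_apply, h₁, h₂,
        Finset.sum_add_distrib]
    | tmul f' g' =>
      simp only [Algebra.TensorProduct.tmul_mul_tmul, pair_tmul, eval_mul_repr _ _ X,
        eval_mul_repr _ _ Y, Finset.sum_mul_sum]
      refine Finset.sum_congr rfl fun i _ => Finset.sum_congr rfl fun j _ => ?_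
      ring

theorem eval_mul_mul {Δ : A →ₐ[K] A ⊗[K] A}
    (hΔ : Coalgebra.comul (R := K) (A := A) = Δ.toLinearMap) (f g : ConvDual K A) {x y : A}
    {ι κ : Type} (X : Coalgebra.Repr K x ι) (Y : Coalgebra.Repr K y κ) :
    eval K A (f * g) (x * y) = ∑ i ∈ X.index, ∑ j ∈ Y.index,
      eval K A f (X.left i * Y.left j) * eval K A g (X.right i * Y.right j) := by
  have h : Coalgebra.comul (R := K) (x * y) = ∑ i ∈ X.index, ∑ j ∈ Y.index,
      (X.left i * Y.left j) ⊗ₜ[K] (X.right i * Y.right j) := by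
    have : Coalgebra.comul (R := K) (x * y) = Coalgebra.comul x * Coalgebra.comul y := by
      simp [hΔ]
    rw [this, ← X.eq, ← Y.eq, Finset.sum_mul_sum]
    simp
  rw [eval_mul, h]
  simp

/-- The pairs `(f, t)` in which `t` describes `f` on products with the factors exchanged. -/
def coproductSubalgebra {Δ : A →ₐ[K] A ⊗[K] A}
    (hΔ : Coalgebra.comul (R := K) (A := A) = Δ.toLinearMap) {ε : A →ₐ[K] K}
    (hε : Coalgebra.counit (R := K) (A := A) = ε.toLinearMap) :
    Subalgebra K (ConvDual K A × (ConvDual K A ⊗[K] ConvDual K A)) where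
  carrier := {p | ∀ x y : A, eval K A p.1 (x * y) = pair K A p.2 (y ⊗ₜ x)}
  mul_mem' := by
    rintro ⟨f, t⟩ ⟨g, u⟩ hf hg x y
    simp only [Set.mem_ofPred_eq] at hf hg
    have X := Coalgebra.Repr.arbitrary K x
    have Y := Coalgebra.Repr.arbitrary K y
    rw [Prod.mk_mul_mk, pair_mul t u Y X, eval_mul_mul hΔ f g X Y, Finset.sum_comm]
    simp only [hf, hg]
  add_mem' := by
    rintro ⟨f, t⟩ ⟨g, u⟩ hf hg x y
    simp only [Set.mem_ofPred_eq] at hf hg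
    simp only [Prod.mk_add_mk, map_add, LinearMap.add_apply, hf, hg]
  algebraMap_mem' c x y := by
    simp [Algebra.algebraMap_eq_smul_one, Algebra.TensorProduct.one_def, eval_one, hε, mul_comm]

/-- Evaluation at a group-like element as a character of the convolution dual. -/
def evalGroupLike (g : A) (hg : Coalgebra.comul (R := K) g = g ⊗ₜ g)
    (hε : Coalgebra.counit (R := K) g = 1) : ConvDual K A →ₐ[K] K :=
  AlgHom.ofLinearMap ((eval K A).toLinearMap.flip g) (by simp [eval_one, hε])
    (fun f f' => by simp [eval_mul, hg])

/-- Evaluation at a skew-primitive element as a triangular representation of the convolution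
dual. -/
theorem exists_evalSkewPrimitive {g e h : A} (hg : Coalgebra.comul (R := K) g = g ⊗ₜ g)
    (hεg : Coalgebra.counit (R := K) g = 1) (hh : Coalgebra.comul (R := K) h = h ⊗ₜ h)
    (hεh : Coalgebra.counit (R := K) h = 1)
    (he : Coalgebra.comul (R := K) e = e ⊗ₜ h + g ⊗ₜ e)
    (hεe : Coalgebra.counit (R := K) e = 0) :
    ∃ ρ : ConvDual K A →ₐ[K] Matrix (Fin 2) (Fin 2) K,
      ∀ f, ρ f = !![eval K A f g, eval K A f e; 0, eval K A f h] := by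
  let ρ : ConvDual K A →ₗ[K] Matrix (Fin 2) (Fin 2) K :=
    { toFun f := !![eval K A f g, eval K A f e; 0, eval K A f h]
      map_add' f f' := by ext i j; fin_cases i <;> fin_cases j <;> simp
      map_smul' c f := by ext i j; fin_cases i <;> fin_cases j <;> simp }
  refine ⟨AlgHom.ofLinearMap ρ ?_ ?_, fun f => rfl⟩
  · ext i j; fin_cases i <;> fin_cases j <;> simp [ρ, eval_one, hεg, hεe, hεh]
  · intro f f'
    ext i j
    fin_cases i <;> fin_cases j <;>
      simp [ρ, eval_mul, hg, hh, he, Matrix.mul_apply, Fin.sum_univ_two, add_comm]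

end ConvDual

end ConvolutionDual

section Pairing

variable {n : ℕ} {a : Fin n → Fin n → ℤ} {d : Fin n → ℤ}

theorem exists_character (hoff : ∀ i j, i ≠ j → a i j ≤ 0) {c : Fin n → K2}
    (hc : ∀ i, c i ≠ 0) : ∃ χ : Ugeq a d →ₐ[K2] K2, (∀ i, χ (gP a d (GenP.e i)) = 0) ∧
      (∀ i, χ (gP a d (GenP.w i)) = c i) ∧ (∀ i, χ (gP a d (GenP.winv i)) = (c i)⁻¹) :=
  exists_liftP (E := fun _ => 0) (W := c) (V := fun i => (c i)⁻¹)
    { comm i j := mul_comm _ _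
      mul_inv i := mul_inv_cancel₀ (hc i)
      inv_mul i := inv_mul_cancel₀ (hc i)
      qcomm i j := by simp
      serre i j hij := serreElt_eq_zero_of_eq_zero hoff hij (Or.inl rfl) }

theorem exists_skewDerivation (hoff : ∀ i j, i ≠ j → a i j ≤ 0) {ε : Ugeq a d →ₐ[K2] K2}
    (hεe : ∀ i, ε (gP a d (GenP.e i)) = 0) (hεw : ∀ i, ε (gP a d (GenP.w i)) = 1)
    (hεv : ∀ i, ε (gP a d (GenP.winv i)) = 1) (i : Fin n) {χ : Ugeq a d →ₐ[K2] K2}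
    (hχe : ∀ j, χ (gP a d (GenP.e j)) = 0)
    (hχw : ∀ j, χ (gP a d (GenP.w j)) = qcoef a d rr ss j i)
    (hχv : ∀ j, χ (gP a d (GenP.winv j)) = (qcoef a d rr ss j i)⁻¹) (c : K2) :
    ∃ φ : Ugeq a d →ₗ[K2] K2, (∀ x y, φ (x * y) = χ x * φ y + φ x * ε y) ∧
      (∀ j, φ (gP a d (GenP.e j)) = if i = j then c else 0) ∧
      (∀ j, φ (gP a d (GenP.w j)) = 0) ∧ (∀ j, φ (gP a d (GenP.winv j)) = 0) := by
  have hq : ∀ j, qcoef a d rr ss j i ≠ 0 := fun j => qcoef_ne_zero j i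
  obtain ⟨ρ, he, hw, hv⟩ := exists_liftP (a := a) (d := d)
    (E := fun j => !![0, if i = j then c else 0; 0, 0])
    (W := fun j => !![qcoef a d rr ss j i, 0; 0, 1])
    (V := fun j => !![(qcoef a d rr ss j i)⁻¹, 0; 0, 1])
    { comm j k := by simp [mul_comm]
      mul_inv j := by simp [hq, Matrix.one_fin_two]
      inv_mul j := by simp [hq, Matrix.one_fin_two]
      qcomm j k := by
        by_cases h : i = k
        · subst h; simp [Matrix.smul_of]
        · simp [h]
      serre j k hjk := by
        refine serreElt_eq_zero_of_eq_zero hoff hjk ?_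
        by_cases h : i = j
        · exact Or.inr (by simp [show i ≠ k from h ▸ hjk, ← Matrix.ext_iff, Fin.forall_fin_two])
        · exact Or.inl (by simp [h, ← Matrix.ext_iff, Fin.forall_fin_two]) }
  have key : ∀ x, ρ x 0 0 = χ x ∧ ρ x 1 0 = 0 ∧ ρ x 1 1 = ε x := by
    intro x
    induction x using Ugeq.induction with
    | one => simp
    | e j => simp [he, hχe, hεe]
    | w j => simp [hw, hχw, hεw]
    | winv j => simp [hv, hχv, hεv]
    | mul x y hx hy => simp [Matrix.mul_apply, Fin.sum_univ_two, hx, hy]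
    | add x y hx hy => simp [hx, hy]
    | smul t x hx => simp [hx]
  refine ⟨(Matrix.entryLinearMap K2 K2 0 1).comp ρ.toLinearMap, ?_, ?_, ?_, ?_⟩
  · intro x y
    simp [Matrix.mul_apply, Fin.sum_univ_two, key]
  · intro j; simp [he]
  · intro j; simp [hw]
  · intro j; simp [hv]

theorem exists_coalgebra (hoff : ∀ i j, i ≠ j → a i j ≤ 0)
    {Δ : Ugeq a d →ₐ[K2] Ugeq a d ⊗[K2] Ugeq a d}
    (hΔe : ∀ i, Δ (gP a d (GenP.e i)) =
      gP a d (GenP.e i) ⊗ₜ[K2] 1 + gP a d (GenP.w i) ⊗ₜ[K2] gP a d (GenP.e i))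
    (hΔw : ∀ i, Δ (gP a d (GenP.w i)) = gP a d (GenP.w i) ⊗ₜ[K2] gP a d (GenP.w i))
    (hΔv : ∀ i, Δ (gP a d (GenP.winv i)) =
      gP a d (GenP.winv i) ⊗ₜ[K2] gP a d (GenP.winv i)) :
    ∃ (C : Coalgebra K2 (Ugeq a d)) (ε : Ugeq a d →ₐ[K2] K2), C.comul = Δ.toLinearMap ∧
      C.counit = ε.toLinearMap ∧ (∀ i, ε (gP a d (GenP.e i)) = 0) ∧
      (∀ i, ε (gP a d (GenP.w i)) = 1) ∧ (∀ i, ε (gP a d (GenP.winv i)) = 1) := by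
  obtain ⟨ε, hεe, hεw, hεv⟩ := exists_character (a := a) (d := d) hoff (c := fun _ => 1) (by simp)
  have key := exists_coalgebra_of_algHom (K := K2) (A := Ugeq a d) Δ ε
  obtain ⟨C, hC, hC'⟩ := key (Ugeq.algHom_ext
    (fun i => by simp [hΔe, hΔw, TensorProduct.add_tmul, TensorProduct.tmul_add,
      Algebra.TensorProduct.one_def, add_assoc])
    (fun i => by simp [hΔw]) (fun i => by simp [hΔv]))
    (Ugeq.algHom_ext (fun i => by simp [hΔe, hεe, hεw]) (fun i => by simp [hΔw, hεw])
      (fun i => by simp [hΔv, hεv]))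
    (Ugeq.algHom_ext (fun i => by simp [hΔe, hεe]) (fun i => by simp [hΔw, hεw])
      (fun i => by simp [hΔv, hεv]))
  exact ⟨C, ε, hC, hC', hεe, hεw, by simpa using hεv⟩

end Pairing

section NegRep

variable {n : ℕ} {a : Fin n → Fin n → ℤ} {d : Fin n → ℤ} [Coalgebra K2 (Ugeq a d)]

/-- The coalgebra structure of `U^{≥0}_{r,s}` is given by algebra homomorphisms `Δ` and `ε` with the
standard values on the generators. -/
structure IsStandard (Δ : Ugeq a d →ₐ[K2] Ugeq a d ⊗[K2] Ugeq a d) (ε : Ugeq a d →ₐ[K2] K2) :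
    Prop where
  comul_eq : Coalgebra.comul (R := K2) (A := Ugeq a d) = Δ.toLinearMap
  counit_eq : Coalgebra.counit (R := K2) (A := Ugeq a d) = ε.toLinearMap
  comul_e : ∀ i, Δ (gP a d (GenP.e i)) =
    gP a d (GenP.e i) ⊗ₜ[K2] 1 + gP a d (GenP.w i) ⊗ₜ[K2] gP a d (GenP.e i)
  comul_w : ∀ i, Δ (gP a d (GenP.w i)) = gP a d (GenP.w i) ⊗ₜ[K2] gP a d (GenP.w i)
  comul_winv : ∀ i, Δ (gP a d (GenP.winv i)) =
    gP a d (GenP.winv i) ⊗ₜ[K2] gP a d (GenP.winv i)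
  counit_e : ∀ i, ε (gP a d (GenP.e i)) = 0
  counit_w : ∀ i, ε (gP a d (GenP.w i)) = 1
  counit_winv : ∀ i, ε (gP a d (GenP.winv i)) = 1

namespace IsStandard

open ConvDual

variable {Δ : Ugeq a d →ₐ[K2] Ugeq a d ⊗[K2] Ugeq a d} {ε : Ugeq a d →ₐ[K2] K2}

/-- Evaluation of the convolution dual at the group-like element `1`. -/
theorem exists_evalOne (H : IsStandard Δ ε) : ∃ ψ : ConvDual K2 (Ugeq a d) →ₐ[K2] K2,
    ∀ f, ψ f = eval K2 (Ugeq a d) f 1 :=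
  ⟨evalGroupLike (K := K2) (A := Ugeq a d) 1
    (by rw [H.comul_eq]; exact (map_one Δ).trans Algebra.TensorProduct.one_def)
    (by rw [H.counit_eq]; exact map_one ε), fun _ => rfl⟩

theorem exists_evalWinv (H : IsStandard Δ ε) (i : Fin n) :
    ∃ ψ : ConvDual K2 (Ugeq a d) →ₐ[K2] K2,
      ∀ f, ψ f = eval K2 (Ugeq a d) f (gP a d (GenP.winv i)) :=
  ⟨evalGroupLike (K := K2) (A := Ugeq a d) _
    (by rw [H.comul_eq]; exact H.comul_winv i) (by rw [H.counit_eq]; exact H.counit_winv i),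
    fun _ => rfl⟩

theorem exists_evalE (H : IsStandard Δ ε) (i : Fin n) :
    ∃ ρ : ConvDual K2 (Ugeq a d) →ₐ[K2] Matrix (Fin 2) (Fin 2) K2,
      ∀ f, ρ f = !![eval K2 (Ugeq a d) f (gP a d (GenP.w i)),
        eval K2 (Ugeq a d) f (gP a d (GenP.e i)); 0, eval K2 (Ugeq a d) f 1] :=
  exists_evalSkewPrimitive (K := K2) (A := Ugeq a d)
    (by rw [H.comul_eq]; exact H.comul_w i) (by rw [H.counit_eq]; exact H.counit_w i)
    (by rw [H.comul_eq]; exact (map_one Δ).trans Algebra.TensorProduct.one_def)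
    (by rw [H.counit_eq]; exact map_one ε)
    (by rw [H.comul_eq]; exact H.comul_e i) (by rw [H.counit_eq]; exact H.counit_e i)

/-- The pairs consisting of a functional and a tensor describing its values on products. -/
abbrev coproducts (H : IsStandard Δ ε) :
    Subalgebra K2 (ConvDual K2 (Ugeq a d) ×
      (ConvDual K2 (Ugeq a d) ⊗[K2] ConvDual K2 (Ugeq a d))) :=
  coproductSubalgebra (K := K2) (A := Ugeq a d) H.comul_eq H.counit_eq

theorem eq_of_mem (H : IsStandard Δ ε) {f g α β : ConvDual K2 (Ugeq a d)}
    {t u : ConvDual K2 (Ugeq a d) ⊗[K2] ConvDual K2 (Ugeq a d)}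
    (hf : (f, t) ∈ H.coproducts)
    (hg : (g, u) ∈ H.coproducts)
    (htu : t - u = α ⊗ₜ[K2] (f - g) + (f - g) ⊗ₜ[K2] β)
    (one : ∀ ψ : ConvDual K2 (Ugeq a d) →ₐ[K2] K2, (∀ f, ψ f = eval K2 (Ugeq a d) f 1) →
      ψ f = ψ g)
    (e : ∀ i, ∀ ρ : ConvDual K2 (Ugeq a d) →ₐ[K2] Matrix (Fin 2) (Fin 2) K2,
      (∀ f, ρ f = !![eval K2 (Ugeq a d) f (gP a d (GenP.w i)),
        eval K2 (Ugeq a d) f (gP a d (GenP.e i)); 0, eval K2 (Ugeq a d) f 1]) → ρ f = ρ g)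
    (winv : ∀ i, ∀ ψ : ConvDual K2 (Ugeq a d) →ₐ[K2] K2,
      (∀ f, ψ f = eval K2 (Ugeq a d) f (gP a d (GenP.winv i))) → ψ f = ψ g) : f = g := by
  have key : (f - g, α ⊗ₜ[K2] (f - g) + (f - g) ⊗ₜ[K2] β) ∈
      H.coproducts := htu ▸ sub_mem hf hg
  have he : ∀ i, eval K2 (Ugeq a d) f (gP a d (GenP.w i)) =
        eval K2 (Ugeq a d) g (gP a d (GenP.w i)) ∧
      eval K2 (Ugeq a d) f (gP a d (GenP.e i)) = eval K2 (Ugeq a d) g (gP a d (GenP.e i)) := by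
    intro i
    obtain ⟨ρ, hρ⟩ := H.exists_evalE i
    have h := e i ρ hρ
    rw [hρ, hρ] at h
    exact ⟨congrFun (congrFun h 0) 0, congrFun (congrFun h 0) 1⟩
  rw [← sub_eq_zero]
  apply (eval K2 (Ugeq a d)).injective
  rw [map_zero]
  refine LinearMap.ext fun x => ?_
  rw [LinearMap.zero_apply]
  induction x using Ugeq.induction with
  | one =>
    obtain ⟨ψ, hψ⟩ := H.exists_evalOne
    rw [← hψ, map_sub, one ψ hψ, sub_self]
  | e i => rw [map_sub, LinearMap.sub_apply, (he i).2, sub_self]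
  | w i => rw [map_sub, LinearMap.sub_apply, (he i).1, sub_self]
  | winv i =>
    obtain ⟨ψ, hψ⟩ := H.exists_evalWinv i
    rw [← hψ, map_sub, winv i ψ hψ, sub_self]
  | mul x y hx hy =>
    rw [key x y, map_add, LinearMap.add_apply, pair_tmul, pair_tmul, hx, hy, mul_zero, zero_mul,
      add_zero]
  | add x y hx hy => rw [map_add, hx, hy, add_zero]
  | smul c x hx => rw [map_smul, hx, smul_zero]

theorem eq_of_mem_groupLike (H : IsStandard Δ ε) {f g : ConvDual K2 (Ugeq a d)}
    (hf : (f, f ⊗ₜ[K2] f) ∈ H.coproducts)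
    (hg : (g, g ⊗ₜ[K2] g) ∈ H.coproducts)
    (one : ∀ ψ : ConvDual K2 (Ugeq a d) →ₐ[K2] K2, (∀ f, ψ f = eval K2 (Ugeq a d) f 1) →
      ψ f = ψ g)
    (e : ∀ i, ∀ ρ : ConvDual K2 (Ugeq a d) →ₐ[K2] Matrix (Fin 2) (Fin 2) K2,
      (∀ f, ρ f = !![eval K2 (Ugeq a d) f (gP a d (GenP.w i)),
        eval K2 (Ugeq a d) f (gP a d (GenP.e i)); 0, eval K2 (Ugeq a d) f 1]) → ρ f = ρ g)
    (winv : ∀ i, ∀ ψ : ConvDual K2 (Ugeq a d) →ₐ[K2] K2,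
      (∀ f, ψ f = eval K2 (Ugeq a d) f (gP a d (GenP.winv i))) → ψ f = ψ g) : f = g :=
  H.eq_of_mem hf hg (α := f) (β := g)
    (by rw [TensorProduct.tmul_sub, TensorProduct.sub_tmul]; abel) one e winv

/-- Functionals `F i`, `W i`, `V i` representing the pairings with `f_i`, `ω'_i`, `ω'_i⁻¹`. -/
structure IsDual (H : IsStandard Δ ε) (F W V : Fin n → ConvDual K2 (Ugeq a d)) : Prop where
  mem_F : ∀ i, (F i, 1 ⊗ₜ[K2] F i + F i ⊗ₜ[K2] W i) ∈ H.coproducts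
  mem_W : ∀ i, (W i, W i ⊗ₜ[K2] W i) ∈ H.coproducts
  mem_V : ∀ i, (V i, V i ⊗ₜ[K2] V i) ∈ H.coproducts
  F_one : ∀ i, eval K2 (Ugeq a d) (F i) 1 = 0
  F_e : ∀ i j, eval K2 (Ugeq a d) (F i) (gP a d (GenP.e j)) =
    if i = j then (ss ^ d i - rr ^ d i)⁻¹ else 0
  F_w : ∀ i j, eval K2 (Ugeq a d) (F i) (gP a d (GenP.w j)) = 0
  F_winv : ∀ i j, eval K2 (Ugeq a d) (F i) (gP a d (GenP.winv j)) = 0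
  W_one : ∀ i, eval K2 (Ugeq a d) (W i) 1 = 1
  W_e : ∀ i j, eval K2 (Ugeq a d) (W i) (gP a d (GenP.e j)) = 0
  W_w : ∀ i j, eval K2 (Ugeq a d) (W i) (gP a d (GenP.w j)) = qcoef a d rr ss j i
  W_winv : ∀ i j, eval K2 (Ugeq a d) (W i) (gP a d (GenP.winv j)) = (qcoef a d rr ss j i)⁻¹
  V_one : ∀ i, eval K2 (Ugeq a d) (V i) 1 = 1
  V_e : ∀ i j, eval K2 (Ugeq a d) (V i) (gP a d (GenP.e j)) = 0
  V_w : ∀ i j, eval K2 (Ugeq a d) (V i) (gP a d (GenP.w j)) = (qcoef a d rr ss j i)⁻¹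
  V_winv : ∀ i j, eval K2 (Ugeq a d) (V i) (gP a d (GenP.winv j)) = qcoef a d rr ss j i

theorem mem_of_algHom (H : IsStandard Δ ε) (χ : Ugeq a d →ₐ[K2] K2) :
    ((eval K2 (Ugeq a d)).symm χ.toLinearMap,
      (eval K2 (Ugeq a d)).symm χ.toLinearMap ⊗ₜ[K2] (eval K2 (Ugeq a d)).symm χ.toLinearMap) ∈
      H.coproducts := by
  intro x y
  rw [pair_tmul, LinearEquiv.apply_symm_apply]
  exact (map_mul χ x y).trans (mul_comm _ _)

theorem exists_isDual (H : IsStandard Δ ε) (hoff : ∀ i j, i ≠ j → a i j ≤ 0) :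
    ∃ F W V, H.IsDual F W V := by
  choose χ hχe hχw hχv using fun i => exists_character (a := a) (d := d) hoff
    (c := fun j => qcoef a d rr ss j i) (fun j => qcoef_ne_zero j i)
  choose ξ hξe hξw hξv using fun i => exists_character (a := a) (d := d) hoff
    (c := fun j => (qcoef a d rr ss j i)⁻¹) (fun j => inv_ne_zero (qcoef_ne_zero j i))
  choose φ hφ hφe hφw hφv using fun i => exists_skewDerivation hoff H.counit_e H.counit_w
    H.counit_winv i (hχe i) (hχw i) (hχv i) (ss ^ d i - rr ^ d i)⁻¹
  refine ⟨fun i => (eval K2 (Ugeq a d)).symm (φ i),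
    fun i => (eval K2 (Ugeq a d)).symm (χ i).toLinearMap,
    fun i => (eval K2 (Ugeq a d)).symm (ξ i).toLinearMap, ?_⟩
  refine
    { mem_F i := ?_
      mem_W i := H.mem_of_algHom (χ i)
      mem_V i := H.mem_of_algHom (ξ i)
      F_one i := ?_
      F_e := hφe
      F_w := hφw
      F_winv := hφv
      W_one i := map_one (χ i)
      W_e := hχe
      W_w := hχw
      W_winv := hχv
      V_one i := map_one (ξ i)
      V_e := hξe
      V_w := hξw
      V_winv i j := (hξv i j).trans (inv_inv _) }
  · intro x y
    rw [map_add, LinearMap.add_apply, pair_tmul, pair_tmul, LinearEquiv.apply_symm_apply,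
      LinearEquiv.apply_symm_apply, eval_one, H.counit_eq]
    refine (hφ i x y).trans ?_
    rw [add_comm, mul_comm (φ i x), mul_comm (χ i x)]
    rfl
  · have h := hφ i 1 1
    rw [mul_one, map_one (χ i), map_one ε, one_mul, mul_one] at h
    exact left_eq_add.mp h

theorem mul_mem_groupLike (H : IsStandard Δ ε) {f g : ConvDual K2 (Ugeq a d)}
    (hf : (f, f ⊗ₜ[K2] f) ∈ H.coproducts)
    (hg : (g, g ⊗ₜ[K2] g) ∈ H.coproducts) :
    (f * g, (f * g) ⊗ₜ[K2] (f * g)) ∈ H.coproducts := by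
  have := mul_mem hf hg
  rwa [Prod.mk_mul_mk, Algebra.TensorProduct.tmul_mul_tmul] at this

theorem one_mem (H : IsStandard Δ ε) :
    ((1 : ConvDual K2 (Ugeq a d)), (1 : ConvDual K2 (Ugeq a d)) ⊗ₜ[K2]
      (1 : ConvDual K2 (Ugeq a d))) ∈ H.coproducts :=
  (H.coproducts).one_mem

namespace IsDual

variable {H : IsStandard Δ ε} {F W V : Fin n → ConvDual K2 (Ugeq a d)}

theorem W_mul_comm (h : H.IsDual F W V) (i j : Fin n) : W i * W j = W j * W i := by
  refine H.eq_of_mem_groupLike (H.mul_mem_groupLike (h.mem_W i) (h.mem_W j))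
    (H.mul_mem_groupLike (h.mem_W j) (h.mem_W i)) ?_ ?_ ?_
  · intro ψ hψ
    rw [map_mul, map_mul, mul_comm]
  · intro l ρ hρ
    rw [map_mul, map_mul]
    simp [hρ, h.W_one, h.W_e, h.W_w, mul_comm]
  · intro l ψ hψ
    rw [map_mul, map_mul, mul_comm]

theorem W_mul_V (h : H.IsDual F W V) (i : Fin n) : W i * V i = 1 := by
  refine H.eq_of_mem_groupLike (H.mul_mem_groupLike (h.mem_W i) (h.mem_V i)) H.one_mem ?_ ?_ ?_
  · intro ψ hψ
    rw [map_mul, map_one, hψ, hψ, h.W_one, h.V_one, one_mul]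
  · intro l ρ hρ
    rw [map_mul, map_one]
    simp [hρ, h.W_one, h.W_e, h.W_w, h.V_one, h.V_e, h.V_w, Matrix.one_fin_two, qcoef_ne_zero]
  · intro l ψ hψ
    rw [map_mul, map_one, hψ, hψ, h.W_winv, h.V_winv, inv_mul_cancel₀ (qcoef_ne_zero l i)]

theorem V_mul_W (h : H.IsDual F W V) (i : Fin n) : V i * W i = 1 := by
  refine H.eq_of_mem_groupLike (H.mul_mem_groupLike (h.mem_V i) (h.mem_W i)) H.one_mem ?_ ?_ ?_
  · intro ψ hψ
    rw [map_mul, map_one, hψ, hψ, h.W_one, h.V_one, one_mul]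
  · intro l ρ hρ
    rw [map_mul, map_one]
    simp [hρ, h.W_one, h.W_e, h.W_w, h.V_one, h.V_e, h.V_w, Matrix.one_fin_two, qcoef_ne_zero]
  · intro l ψ hψ
    rw [map_mul, map_one, hψ, hψ, h.W_winv, h.V_winv, mul_inv_cancel₀ (qcoef_ne_zero l i)]

theorem W_mul_F (h : H.IsDual F W V) (i j : Fin n) :
    W i * F j = qcoef a d rr ss j i • (F j * W i) := by
  have h₁ := mul_mem (h.mem_W i) (h.mem_F j)
  have h₂ := H.coproducts.smul_mem (mul_mem (h.mem_F j) (h.mem_W i)) (qcoef a d rr ss j i)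
  rw [Prod.mk_mul_mk] at h₁ h₂
  rw [Prod.smul_mk] at h₂
  refine H.eq_of_mem (α := W i) (β := W i * W j) h₁ h₂ ?_ ?_ ?_ ?_
  · rw [mul_add, add_mul, Algebra.TensorProduct.tmul_mul_tmul, Algebra.TensorProduct.tmul_mul_tmul,
      Algebra.TensorProduct.tmul_mul_tmul, Algebra.TensorProduct.tmul_mul_tmul, mul_one, one_mul,
      h.W_mul_comm j i, smul_add, ← TensorProduct.tmul_smul, TensorProduct.smul_tmul',
      TensorProduct.tmul_sub, TensorProduct.sub_tmul]
    abel
  · intro ψ hψ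
    rw [map_smul, map_mul, map_mul, hψ (F j), h.F_one, mul_zero, zero_mul, smul_zero]
  · intro l ρ hρ
    rw [map_smul, map_mul, map_mul]
    by_cases hjl : j = l
    · subst hjl
      simp [hρ, h.W_one, h.W_e, h.W_w, h.F_one, h.F_e, h.F_w, Matrix.smul_of]
    · simp [hρ, h.W_one, h.W_e, h.W_w, h.F_one, h.F_e, h.F_w, hjl]
  · intro l ψ hψ
    rw [map_smul, map_mul, map_mul, hψ (F j), h.F_winv, mul_zero, zero_mul, smul_zero]

theorem serreEltF_eq_zero (h : H.IsDual F W V) (hoff : ∀ i j, i ≠ j → a i j ≤ 0)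
    (hsym : ∀ i j, d i * a i j = d j * a j i) {i j : Fin n} (hij : i ≠ j) :
    serreEltF a d rr ss F i j = 0 := by
  let G : Fin n → H.coproducts := fun k => ⟨_, h.mem_F k⟩
  have hG : (serreEltF a d rr ss F i j,
      serreEltF a d rr ss (fun k => (1 : ConvDual K2 (Ugeq a d)) ⊗ₜ[K2] F k + F k ⊗ₜ[K2] W k)
        i j) ∈ H.coproducts := by
    have h₁ := map_serreEltF (a := a) (d := d) (r := rr) (s := ss)
      ((AlgHom.fst K2 _ _).comp H.coproducts.val) G i j
    have h₂ := map_serreEltF (a := a) (d := d) (r := rr) (s := ss)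
      ((AlgHom.snd K2 _ _).comp H.coproducts.val) G i j
    have h₃ := (serreEltF a d rr ss G i j).2
    convert h₃ using 1
    exact Prod.ext h₁.symm h₂.symm
  have hz : ∀ ψ : ConvDual K2 (Ugeq a d) →ₐ[K2] K2, (∀ k, ψ (F k) = 0) →
      ψ (serreEltF a d rr ss F i j) = ψ 0 := fun ψ hψ => by
    rw [map_zero, map_serreEltF]
    exact serreEltF_eq_zero_of_eq_zero hoff hij (Or.inl (hψ i))
  have h₀ : ((0 : ConvDual K2 (Ugeq a d)),
      (0 : ConvDual K2 (Ugeq a d) ⊗[K2] ConvDual K2 (Ugeq a d))) ∈ H.coproducts :=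
    H.coproducts.zero_mem
  refine H.eq_of_mem hG h₀ (α := 1) (β := W i ^ (1 - a i j).toNat * W j) ?_
    (fun ψ hψ => hz ψ fun k => (hψ _).trans (h.F_one k)) ?_
    (fun l ψ hψ => hz ψ fun k => (hψ _).trans (h.F_winv k l))
  · rw [serreEltF_coproduct hoff hsym h.W_mul_comm h.W_mul_F hij, sub_zero,
      sub_zero]
  · intro l ρ hρ
    rw [map_zero, map_serreEltF]
    refine serreEltF_eq_zero_of_eq_zero hoff hij ?_
    have hk : ∀ k, k ≠ l → ρ (F k) = 0 := fun k hkl => by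
      simp [hρ, h.F_one, h.F_e, h.F_w, hkl, ← Matrix.ext_iff, Fin.forall_fin_two]
    by_cases hil : i = l
    · exact Or.inr (hk j fun hjl => hij (hil.trans hjl.symm))
    · exact Or.inl (hk i hil)

theorem isNegRep (h : H.IsDual F W V) (hoff : ∀ i j, i ≠ j → a i j ≤ 0)
    (hsym : ∀ i j, d i * a i j = d j * a j i) : IsNegRep a d F W V where
  comm := h.W_mul_comm
  mul_inv := h.W_mul_V
  inv_mul := h.V_mul_W
  qcomm := h.W_mul_F
  serre _ _ hij := h.serreEltF_eq_zero hoff hsym hij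

end IsDual

end IsStandard

end NegRep

section TorusPowers

variable {n : ℕ} {a : Fin n → Fin n → ℤ} {d : Fin n → ℤ}

theorem wPow_mem {S : Submonoid (Ugeq a d)} (hw : ∀ i, gP a d (GenP.w i) ∈ S)
    (hv : ∀ i, gP a d (GenP.winv i) ∈ S) (μ : Fin n → ℤ) : wPow a d μ ∈ S := by
  refine S.list_prod_mem fun x hx => ?_
  obtain ⟨i, -, rfl⟩ := List.mem_map.mp hx
  split_ifs
  exacts [pow_mem (hw i) _, pow_mem (hv i) _]

theorem w'Pow_mem {S : Submonoid (Uleq a d)} (hw : ∀ i, gM a d (GenM.w' i) ∈ S)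
    (hv : ∀ i, gM a d (GenM.w'inv i) ∈ S) (μ : Fin n → ℤ) : w'Pow a d μ ∈ S := by
  refine S.list_prod_mem fun x hx => ?_
  obtain ⟨i, -, rfl⟩ := List.mem_map.mp hx
  split_ifs
  exacts [pow_mem (hw i) _, pow_mem (hv i) _]

theorem ite_pow_eq_zpow {K : Type} [Field K] {c c' : K} (h : c * c' = 1) (m : ℤ) :
    (if 0 ≤ m then c ^ m.toNat else c' ^ (-m).toNat) = c ^ m := by
  rw [eq_inv_of_mul_eq_one_right h]
  split_ifs with hm
  · rw [← zpow_natCast, Int.toNat_of_nonneg hm]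
  · rw [inv_pow, ← zpow_natCast, Int.toNat_of_nonneg (by lia), zpow_neg, inv_inv]

theorem algHom_wPow (ψ : Ugeq a d →ₐ[K2] K2) (μ : Fin n → ℤ) :
    ψ (wPow a d μ) = ∏ i, ψ (gP a d (GenP.w i)) ^ μ i := by
  rw [wPow, map_list_prod, List.map_map, Fin.prod_univ_def]
  congr 2
  funext i
  have h : ψ (gP a d (GenP.w i)) * ψ (gP a d (GenP.winv i)) = 1 := by
    rw [← map_mul, isPosRep_gP.mul_inv, map_one]
  rw [← ite_pow_eq_zpow h, Function.comp_apply, apply_ite ψ, map_pow, map_pow]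

theorem algHom_w'Pow (ψ : Uleq a d →ₐ[K2] K2) (μ : Fin n → ℤ) :
    ψ (w'Pow a d μ) = ∏ i, ψ (gM a d (GenM.w' i)) ^ μ i := by
  rw [w'Pow, map_list_prod, List.map_map, Fin.prod_univ_def]
  congr 2
  funext i
  have h : ψ (gM a d (GenM.w' i)) * ψ (gM a d (GenM.w'inv i)) = 1 := by
    rw [← map_mul, isNegRep_gM.mul_inv, map_one]
  rw [← ite_pow_eq_zpow h, Function.comp_apply, apply_ite ψ, map_pow, map_pow]

theorem prod_qcoef (μ ν : Fin n → ℤ) : ∏ i, (∏ j, qcoef a d rr ss j i ^ ν j) ^ μ i =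
    rr ^ euler a d μ ν * (ss ^ euler a d ν μ)⁻¹ := by
  have hz : ∀ {x : K2}, x ≠ 0 → ∀ f : Fin n → ℤ, x ^ ∑ i, f i = ∏ i, x ^ f i := by
    intro x hx f
    induction (Finset.univ : Finset (Fin n)) using Finset.induction_on with
    | empty => simp
    | insert i s hi h => rw [Finset.sum_insert hi, Finset.prod_insert hi, zpow_add₀ hx, h]
  rw [show euler a d ν μ = ∑ i, ∑ j, ν j * μ i * eulB a d j i from Finset.sum_comm, euler,
    hz rr_ne_zero, hz ss_ne_zero, ← Finset.prod_inv_distrib, ← Finset.prod_mul_distrib]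
  refine Finset.prod_congr rfl fun i _ => ?_
  rw [hz rr_ne_zero, hz ss_ne_zero, ← Finset.prod_inv_distrib, ← Finset.prod_mul_distrib,
    ← Finset.prod_zpow]
  refine Finset.prod_congr rfl fun j _ => ?_
  rw [qcoef, mul_zpow, mul_zpow, inv_zpow, inv_zpow, ← zpow_mul, ← zpow_mul, ← zpow_mul,
    ← zpow_mul]
  congr 2 <;> ring_nf

theorem prod_map_eq_of_forall_ne {M ι : Type} [Monoid M] {f : ι → M} {i : ι}
    (hf : ∀ j, j ≠ i → f j = 1) {l : List ι} (hl : l.Nodup) (hi : i ∈ l) :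
    (l.map f).prod = f i := by
  obtain ⟨s, t, rfl⟩ := List.append_of_mem hi
  have hs : (s.map f).prod = 1 := List.prod_eq_one fun x hx => by
    obtain ⟨j, hj, rfl⟩ := List.mem_map.mp hx
    exact hf j (by rintro rfl; simp [List.nodup_append] at hl; grind)
  have ht : (t.map f).prod = 1 := List.prod_eq_one fun x hx => by
    obtain ⟨j, hj, rfl⟩ := List.mem_map.mp hx
    exact hf j (by rintro rfl; simp [List.nodup_append] at hl; grind)
  rw [List.map_append, List.prod_append, List.map_cons, List.prod_cons, hs, ht, one_mul, mul_one]

theorem wPow_zero : wPow a d 0 = 1 := by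
  simp [wPow]

theorem wPow_single (i : Fin n) : wPow a d (Pi.single i 1) = gP a d (GenP.w i) := by
  rw [wPow, prod_map_eq_of_forall_ne (i := i) _ (List.nodup_finRange n) (List.mem_finRange i)]
  · simp
  · intro j hj
    simp [Pi.single_eq_of_ne hj]

theorem wPow_neg_single (i : Fin n) : wPow a d (-Pi.single i 1) = gP a d (GenP.winv i) := by
  rw [wPow, prod_map_eq_of_forall_ne (i := i) _ (List.nodup_finRange n) (List.mem_finRange i)]
  · simp
  · intro j hj
    simp [Pi.single_eq_of_ne hj]

theorem w'Pow_zero : w'Pow a d 0 = 1 := by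
  simp [w'Pow]

theorem w'Pow_single (i : Fin n) : w'Pow a d (Pi.single i 1) = gM a d (GenM.w' i) := by
  rw [w'Pow, prod_map_eq_of_forall_ne (i := i) _ (List.nodup_finRange n) (List.mem_finRange i)]
  · simp
  · intro j hj
    simp [Pi.single_eq_of_ne hj]

theorem w'Pow_neg_single (i : Fin n) : w'Pow a d (-Pi.single i 1) = gM a d (GenM.w'inv i) := by
  rw [w'Pow, prod_map_eq_of_forall_ne (i := i) _ (List.nodup_finRange n) (List.mem_finRange i)]
  · simp
  · intro j hj
    simp [Pi.single_eq_of_ne hj]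

end TorusPowers

section SkewPairing

variable {n : ℕ} {a : Fin n → Fin n → ℤ} {d : Fin n → ℤ}

@[simp]
theorem pairT_tmul {M N : Type} [AddCommGroup M] [AddCommGroup N] [Module K2 M] [Module K2 N]
    (B : M →ₗ[K2] N →ₗ[K2] K2) (y y' : M) (x x' : N) :
    pairT B (y ⊗ₜ[K2] y') (x ⊗ₜ[K2] x') = B y x * B y' x' := by
  simp [pairT]

/-- The defining properties of the skew pairing of the two Borel subalgebras. -/
structure IsSkewPairing (Δp : Ugeq a d →ₐ[K2] Ugeq a d ⊗[K2] Ugeq a d)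
    (Δm : Uleq a d →ₐ[K2] Uleq a d ⊗[K2] Uleq a d)
    (B : Uleq a d →ₗ[K2] Ugeq a d →ₗ[K2] K2) : Prop where
  mul_right : ∀ (y : Uleq a d) (x x' : Ugeq a d),
    B y (x * x') = pairT (M := Uleq a d) (N := Ugeq a d) B (Δm y) (x' ⊗ₜ[K2] x)
  mul_left : ∀ (y y' : Uleq a d) (x : Ugeq a d),
    B (y * y') x = pairT (M := Uleq a d) (N := Ugeq a d) B (y ⊗ₜ[K2] y') (Δp x)
  f_e : ∀ i j, B (gM a d (GenM.f i)) (gP a d (GenP.e j)) =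
    if i = j then (ss ^ d i - rr ^ d i)⁻¹ else 0
  w'Pow_wPow : ∀ μ ν : Fin n → ℤ,
    B (w'Pow a d μ) (wPow a d ν) = rr ^ euler a d μ ν * (ss ^ euler a d ν μ)⁻¹
  w'Pow_e : ∀ (μ : Fin n → ℤ) (i : Fin n), B (w'Pow a d μ) (gP a d (GenP.e i)) = 0
  f_wPow : ∀ (i : Fin n) (μ : Fin n → ℤ), B (gM a d (GenM.f i)) (wPow a d μ) = 0

section Existence

variable [Coalgebra K2 (Ugeq a d)] {Δ : Ugeq a d →ₐ[K2] Ugeq a d ⊗[K2] Ugeq a d}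
  {ε : Ugeq a d →ₐ[K2] K2} {H : IsStandard Δ ε} {F W V : Fin n → ConvDual K2 (Ugeq a d)}

open ConvDual

namespace IsStandard.IsDual

theorem map_mem_coproducts (h : H.IsDual F W V)
    {Δm : Uleq a d →ₐ[K2] Uleq a d ⊗[K2] Uleq a d}
    (hΔf : ∀ i, Δm (gM a d (GenM.f i)) =
      1 ⊗ₜ[K2] gM a d (GenM.f i) + gM a d (GenM.f i) ⊗ₜ[K2] gM a d (GenM.w' i))
    (hΔw : ∀ i, Δm (gM a d (GenM.w' i)) = gM a d (GenM.w' i) ⊗ₜ[K2] gM a d (GenM.w' i))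
    (hΔv : ∀ i, Δm (gM a d (GenM.w'inv i)) =
      gM a d (GenM.w'inv i) ⊗ₜ[K2] gM a d (GenM.w'inv i))
    {φ : Uleq a d →ₐ[K2] ConvDual K2 (Ugeq a d)} (hφf : ∀ i, φ (gM a d (GenM.f i)) = F i)
    (hφw : ∀ i, φ (gM a d (GenM.w' i)) = W i) (hφv : ∀ i, φ (gM a d (GenM.w'inv i)) = V i)
    (y : Uleq a d) :
    (φ y, Algebra.TensorProduct.map (A := Uleq a d) (B := Uleq a d) φ φ (Δm y)) ∈
      H.coproducts := by
  have key : φ.prod ((Algebra.TensorProduct.map (A := Uleq a d) (B := Uleq a d) φ φ).comp Δm) y ∈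
      H.coproducts := by
    induction y using Uleq.induction with
    | one => rw [map_one]; exact one_mem _
    | f i =>
      convert h.mem_F i using 1
      refine Prod.ext (hφf i) ?_
      simp [hΔf, hφf, hφw]
    | w' i =>
      convert h.mem_W i using 1
      refine Prod.ext (hφw i) ?_
      simp [hΔw, hφw]
    | w'inv i =>
      convert h.mem_V i using 1
      refine Prod.ext (hφv i) ?_
      simp [hΔv, hφv]
    | mul x y hx hy => rw [map_mul]; exact mul_mem hx hy
    | add x y hx hy => rw [map_add]; exact add_mem hx hy
    | smul c x hx => rw [map_smul]; exact H.coproducts.smul_mem hx c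
  exact key

theorem pairT_eq_pair (φ : Uleq a d →ₐ[K2] ConvDual K2 (Ugeq a d))
    (t : Uleq a d ⊗[K2] Uleq a d) :
    pairT (M := Uleq a d) (N := Ugeq a d) ((eval K2 (Ugeq a d)).toLinearMap.comp φ.toLinearMap) t =
      pair K2 (Ugeq a d) (Algebra.TensorProduct.map (A := Uleq a d) (B := Uleq a d) φ φ t) := by
  induction t with
  | zero => simp
  | add t u ht hu => rw [map_add, map_add, map_add, ht, hu]
  | tmul y y' =>
    refine TensorProduct.ext' fun x x' => ?_
    rw [pairT_tmul, Algebra.TensorProduct.map_tmul, pair_tmul]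
    rfl

theorem eval_mul_eq_pairT (φ : Uleq a d →ₐ[K2] ConvDual K2 (Ugeq a d)) (H : IsStandard Δ ε)
    (y y' : Uleq a d) (x : Ugeq a d) :
    eval K2 (Ugeq a d) (φ (y * y')) x = pairT (M := Uleq a d) (N := Ugeq a d)
      ((eval K2 (Ugeq a d)).toLinearMap.comp φ.toLinearMap) (y ⊗ₜ[K2] y') (Δ x) := by
  rw [map_mul, eval_mul, H.comul_eq, AlgHom.toLinearMap_apply]
  induction Δ x with
  | zero => simp
  | add t u ht hu => rw [map_add, map_add, map_add, ht, hu]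
  | tmul z z' =>
    rw [pairT_tmul, TensorProduct.map_tmul]
    rfl

theorem eval_F_wPow (h : H.IsDual F W V) (i : Fin n) (μ : Fin n → ℤ) :
    eval K2 (Ugeq a d) (F i) (wPow a d μ) = 0 := by
  let S : Submonoid (Ugeq a d) :=
    { carrier := {x | eval K2 (Ugeq a d) (F i) x = 0}
      one_mem' := h.F_one i
      mul_mem' := by
        intro x y hx hy
        rw [Set.mem_ofPred_eq] at hx hy ⊢
        rw [h.mem_F i x y, map_add, LinearMap.add_apply, pair_tmul, pair_tmul, hx, hy, mul_zero,
          zero_mul, add_zero] }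
  exact wPow_mem (S := S) (h.F_w i) (h.F_winv i) μ

theorem eval_W_wPow (h : H.IsDual F W V) (i : Fin n) (ν : Fin n → ℤ) :
    eval K2 (Ugeq a d) (W i) (wPow a d ν) = ∏ j, qcoef a d rr ss j i ^ ν j := by
  let χ : Ugeq a d →ₐ[K2] K2 := AlgHom.ofLinearMap (eval K2 (Ugeq a d) (W i)) (h.W_one i)
    fun x y => by rw [h.mem_W i x y, pair_tmul, mul_comm]
  refine (algHom_wPow χ ν).trans (Finset.prod_congr rfl fun j _ => ?_)
  exact congrArg (· ^ ν j) (h.W_w i j)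

end IsStandard.IsDual

theorem IsStandard.comul_wPow (H : IsStandard Δ ε) (ν : Fin n → ℤ) :
    Δ (wPow a d ν) = wPow a d ν ⊗ₜ[K2] wPow a d ν ∧ ε (wPow a d ν) = 1 := by
  let S : Submonoid (Ugeq a d) :=
    { carrier := {x | Δ x = x ⊗ₜ[K2] x ∧ ε x = 1}
      one_mem' := ⟨(map_one Δ).trans Algebra.TensorProduct.one_def, map_one ε⟩
      mul_mem' := by
        rintro x y ⟨hx, hx'⟩ ⟨hy, hy'⟩
        refine ⟨?_, ?_⟩
        · rw [map_mul, hx, hy, Algebra.TensorProduct.tmul_mul_tmul]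
        · rw [map_mul, hx', hy', one_mul] }
  exact wPow_mem (S := S) (fun i => ⟨H.comul_w i, H.counit_w i⟩)
    (fun i => ⟨H.comul_winv i, H.counit_winv i⟩) ν

end Existence

theorem exists_isSkewPairing (hoff : ∀ i j, i ≠ j → a i j ≤ 0)
    (hsym : ∀ i j, d i * a i j = d j * a j i)
    {Δp : Ugeq a d →ₐ[K2] Ugeq a d ⊗[K2] Ugeq a d}
    (hpe : ∀ i, Δp (gP a d (GenP.e i)) =
      gP a d (GenP.e i) ⊗ₜ[K2] 1 + gP a d (GenP.w i) ⊗ₜ[K2] gP a d (GenP.e i))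
    (hpw : ∀ i, Δp (gP a d (GenP.w i)) = gP a d (GenP.w i) ⊗ₜ[K2] gP a d (GenP.w i))
    (hpv : ∀ i, Δp (gP a d (GenP.winv i)) = gP a d (GenP.winv i) ⊗ₜ[K2] gP a d (GenP.winv i))
    {Δm : Uleq a d →ₐ[K2] Uleq a d ⊗[K2] Uleq a d}
    (hmf : ∀ i, Δm (gM a d (GenM.f i)) =
      1 ⊗ₜ[K2] gM a d (GenM.f i) + gM a d (GenM.f i) ⊗ₜ[K2] gM a d (GenM.w' i))
    (hmw : ∀ i, Δm (gM a d (GenM.w' i)) = gM a d (GenM.w' i) ⊗ₜ[K2] gM a d (GenM.w' i))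
    (hmv : ∀ i, Δm (gM a d (GenM.w'inv i)) =
      gM a d (GenM.w'inv i) ⊗ₜ[K2] gM a d (GenM.w'inv i)) :
    ∃ B : Uleq a d →ₗ[K2] Ugeq a d →ₗ[K2] K2, IsSkewPairing Δp Δm B := by
  obtain ⟨C, ε, hC, hC', hεe, hεw, hεv⟩ := exists_coalgebra hoff hpe hpw hpv
  have H : IsStandard Δp ε := ⟨hC, hC', hpe, hpw, hpv, hεe, hεw, hεv⟩
  obtain ⟨F, W, V, h⟩ := H.exists_isDual hoff
  obtain ⟨φ, hφf, hφw, hφv⟩ := exists_liftM (h.isNegRep hoff hsym)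
  refine ⟨(ConvDual.eval K2 (Ugeq a d)).toLinearMap.comp φ.toLinearMap, ?_, ?_, ?_, ?_, ?_, ?_⟩
  · intro y x x'
    rw [IsStandard.IsDual.pairT_eq_pair]
    exact h.map_mem_coproducts hmf hmw hmv hφf hφw hφv y x x'
  · intro y y' x
    exact IsStandard.IsDual.eval_mul_eq_pairT φ H y y' x
  · intro i j
    refine Eq.trans ?_ (h.F_e i j)
    exact congrArg (fun f => ConvDual.eval K2 (Ugeq a d) f (gP a d (GenP.e j))) (hφf i)
  · intro μ ν
    let ψ : ConvDual K2 (Ugeq a d) →ₐ[K2] K2 :=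
      ConvDual.evalGroupLike (K := K2) (A := Ugeq a d) (wPow a d ν)
        (by rw [H.comul_eq]; exact (H.comul_wPow ν).1)
        (by rw [H.counit_eq]; exact (H.comul_wPow ν).2)
    rw [← prod_qcoef]
    refine (algHom_w'Pow (ψ.comp φ) μ).trans (Finset.prod_congr rfl fun i _ => ?_)
    rw [AlgHom.comp_apply, hφw]
    exact congrArg (· ^ μ i) (h.eval_W_wPow i ν)
  · intro μ i
    obtain ⟨ρ, hρ⟩ := H.exists_evalE i
    let S : Submonoid (Uleq a d) :=
      { carrier := {y | ρ (φ y) 0 1 = 0}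
        one_mem' := by
          rw [Set.mem_ofPred_eq, map_one, map_one]
          exact Matrix.one_apply_ne zero_ne_one
        mul_mem' := by
          intro x y hx hy
          rw [Set.mem_ofPred_eq] at hx hy ⊢
          rw [map_mul, map_mul, Matrix.mul_apply, Fin.sum_univ_two, hx, hy, mul_zero, zero_mul,
            add_zero] }
    have hS : w'Pow a d μ ∈ S := w'Pow_mem
      (fun j => by
        change ρ (φ _) 0 1 = 0
        rw [hφw, hρ]
        exact h.W_e j i)
      (fun j => by
        change ρ (φ _) 0 1 = 0
        rw [hφv, hρ]
        exact h.V_e j i) μ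
    change ρ (φ _) 0 1 = 0 at hS
    rw [hρ] at hS
    exact hS
  · intro i μ
    refine Eq.trans ?_ (h.eval_F_wPow i μ)
    exact congrArg (fun f => ConvDual.eval K2 (Ugeq a d) f (wPow a d μ)) (hφf i)

theorem linearMap_ext_of_mul {f g : Ugeq a d →ₗ[K2] K2} (one : f 1 = g 1)
    (e : ∀ i, f (gP a d (GenP.e i)) = g (gP a d (GenP.e i)))
    (w : ∀ i, f (gP a d (GenP.w i)) = g (gP a d (GenP.w i)))
    (winv : ∀ i, f (gP a d (GenP.winv i)) = g (gP a d (GenP.winv i)))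
    (mul : ∀ x y, f x = g x → f y = g y → f (x * y) = g (x * y)) : f = g := by
  refine LinearMap.ext fun x => ?_
  induction x using Ugeq.induction with
  | one => exact one
  | e i => exact e i
  | w i => exact w i
  | winv i => exact winv i
  | mul x y hx hy => exact mul x y hx hy
  | add x y hx hy => rw [map_add, map_add, hx, hy]
  | smul c x hx => rw [map_smul, map_smul, hx]

namespace IsSkewPairing

variable {Δp : Ugeq a d →ₐ[K2] Ugeq a d ⊗[K2] Ugeq a d}
  {Δm : Uleq a d →ₐ[K2] Uleq a d ⊗[K2] Uleq a d} {B B' : Uleq a d →ₗ[K2] Ugeq a d →ₗ[K2] K2}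

theorem apply_w'Pow_eq (h : IsSkewPairing Δp Δm B) (h' : IsSkewPairing Δp Δm B')
    {μ : Fin n → ℤ} (hμ : Δm (w'Pow a d μ) = w'Pow a d μ ⊗ₜ[K2] w'Pow a d μ) :
    B (w'Pow a d μ) = B' (w'Pow a d μ) := by
  apply linearMap_ext_of_mul
  · rw [← wPow_zero, h.w'Pow_wPow, h'.w'Pow_wPow]
  · intro i; rw [h.w'Pow_e, h'.w'Pow_e]
  · intro i; rw [← wPow_single, h.w'Pow_wPow, h'.w'Pow_wPow]
  · intro i; rw [← wPow_neg_single, h.w'Pow_wPow, h'.w'Pow_wPow]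
  · intro x y hx hy
    rw [h.mul_right, h'.mul_right, hμ, pairT_tmul, pairT_tmul, hx, hy]

theorem unique (h : IsSkewPairing Δp Δm B) (h' : IsSkewPairing Δp Δm B')
    (hmf : ∀ i, Δm (gM a d (GenM.f i)) =
      1 ⊗ₜ[K2] gM a d (GenM.f i) + gM a d (GenM.f i) ⊗ₜ[K2] gM a d (GenM.w' i))
    (hmw : ∀ i, Δm (gM a d (GenM.w' i)) = gM a d (GenM.w' i) ⊗ₜ[K2] gM a d (GenM.w' i))
    (hmv : ∀ i, Δm (gM a d (GenM.w'inv i)) =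
      gM a d (GenM.w'inv i) ⊗ₜ[K2] gM a d (GenM.w'inv i)) : B = B' := by
  have h_one : B 1 = B' 1 := by
    rw [← w'Pow_zero]
    refine h.apply_w'Pow_eq h' ?_
    rw [w'Pow_zero, map_one, Algebra.TensorProduct.one_def]
  have h_w' : ∀ i, B (gM a d (GenM.w' i)) = B' (gM a d (GenM.w' i)) := fun i => by
    rw [← w'Pow_single]
    refine h.apply_w'Pow_eq h' ?_
    rw [w'Pow_single, hmw]
  refine LinearMap.ext fun y => ?_
  induction y using Uleq.induction with
  | one => exact h_one
  | f i =>
    apply linearMap_ext_of_mul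
    · rw [← wPow_zero, h.f_wPow, h'.f_wPow]
    · intro j; rw [h.f_e, h'.f_e]
    · intro j; rw [← wPow_single, h.f_wPow, h'.f_wPow]
    · intro j; rw [← wPow_neg_single, h.f_wPow, h'.f_wPow]
    · intro x y hx hy
      rw [h.mul_right, h'.mul_right, hmf, map_add, map_add, LinearMap.add_apply,
        LinearMap.add_apply, pairT_tmul, pairT_tmul, pairT_tmul, pairT_tmul, hx, hy, h_one, h_w']
  | w' i => exact h_w' i
  | w'inv i =>
    rw [← w'Pow_neg_single]
    refine h.apply_w'Pow_eq h' ?_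
    rw [w'Pow_neg_single, hmv]
  | mul y y' hy hy' =>
    refine LinearMap.ext fun x => ?_
    rw [h.mul_left, h'.mul_left]
    induction Δp x with
    | zero => rw [map_zero, map_zero]
    | add t u ht hu => rw [map_add, map_add, ht, hu]
    | tmul z z' => rw [pairT_tmul, pairT_tmul, hy, hy']
  | add y y' hy hy' => rw [map_add, map_add, hy, hy']
  | smul c y hy => rw [map_smul, map_smul, hy]

end IsSkewPairing

end SkewPairing

/-- **Proposition 2.4.** There is a unique bilinear (skew) pairing
`( , ) : U^{≤0}_{r,s} × U^{≥0}_{r,s} → ℚ(r,s)` such that `(y, xx') = (Δ(y), x' ⊗ x)`,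
`(yy', x) = (y ⊗ y', Δ(x))`, `(f_i, e_j) = δ_{ij}/(s_i - r_i)`,
`(ω'_μ, ω_ν) = r^{⟨μ,ν⟩} s^{-⟨ν,μ⟩}`, `(ω'_μ, e_i) = 0` and `(f_i, ω_μ) = 0`. -/
theorem existsUnique_skew_pairing
    (n : ℕ) (a : Fin n → Fin n → ℤ) (d : Fin n → ℤ)
    (hdiag : ∀ i, a i i = 2) (hoff : ∀ i j, i ≠ j → a i j ≤ 0)
    (hsym : ∀ i j, d i * a i j = d j * a j i) (hdpos : ∀ i, 0 < d i)
    (hfin : Matrix.PosDef (Matrix.of fun i j : Fin n => ((d i * a i j : ℤ) : ℝ))) :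
    (∃ Δp : Ugeq a d →ₐ[K2] (Ugeq a d ⊗[K2] Ugeq a d),
      (∀ i, Δp (gP a d (GenP.e i)) =
          gP a d (GenP.e i) ⊗ₜ[K2] 1 + gP a d (GenP.w i) ⊗ₜ[K2] gP a d (GenP.e i)) ∧
      (∀ i, Δp (gP a d (GenP.w i)) = gP a d (GenP.w i) ⊗ₜ[K2] gP a d (GenP.w i)) ∧
      (∀ i, Δp (gP a d (GenP.winv i)) = gP a d (GenP.winv i) ⊗ₜ[K2] gP a d (GenP.winv i))) ∧
    (∃ Δm : Uleq a d →ₐ[K2] (Uleq a d ⊗[K2] Uleq a d),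
      (∀ i, Δm (gM a d (GenM.f i)) =
          1 ⊗ₜ[K2] gM a d (GenM.f i) + gM a d (GenM.f i) ⊗ₜ[K2] gM a d (GenM.w' i)) ∧
      (∀ i, Δm (gM a d (GenM.w' i)) = gM a d (GenM.w' i) ⊗ₜ[K2] gM a d (GenM.w' i)) ∧
      (∀ i, Δm (gM a d (GenM.w'inv i)) =
          gM a d (GenM.w'inv i) ⊗ₜ[K2] gM a d (GenM.w'inv i))) ∧
    (∀ (Δp : Ugeq a d →ₐ[K2] (Ugeq a d ⊗[K2] Ugeq a d))
        (Δm : Uleq a d →ₐ[K2] (Uleq a d ⊗[K2] Uleq a d)),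
      ((∀ i, Δp (gP a d (GenP.e i)) =
          gP a d (GenP.e i) ⊗ₜ[K2] 1 + gP a d (GenP.w i) ⊗ₜ[K2] gP a d (GenP.e i)) ∧
       (∀ i, Δp (gP a d (GenP.w i)) = gP a d (GenP.w i) ⊗ₜ[K2] gP a d (GenP.w i)) ∧
       (∀ i, Δp (gP a d (GenP.winv i)) =
          gP a d (GenP.winv i) ⊗ₜ[K2] gP a d (GenP.winv i))) →
      ((∀ i, Δm (gM a d (GenM.f i)) =
          1 ⊗ₜ[K2] gM a d (GenM.f i) + gM a d (GenM.f i) ⊗ₜ[K2] gM a d (GenM.w' i)) ∧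
       (∀ i, Δm (gM a d (GenM.w' i)) = gM a d (GenM.w' i) ⊗ₜ[K2] gM a d (GenM.w' i)) ∧
       (∀ i, Δm (gM a d (GenM.w'inv i)) =
          gM a d (GenM.w'inv i) ⊗ₜ[K2] gM a d (GenM.w'inv i))) →
      ∃! B : Uleq a d →ₗ[K2] Ugeq a d →ₗ[K2] K2,
        (∀ (y : Uleq a d) (x x' : Ugeq a d),
            B y (x * x') = pairT (M := Uleq a d) (N := Ugeq a d) B (Δm y) (x' ⊗ₜ[K2] x)) ∧
        (∀ (y y' : Uleq a d) (x : Ugeq a d),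
            B (y * y') x = pairT (M := Uleq a d) (N := Ugeq a d) B (y ⊗ₜ[K2] y') (Δp x)) ∧
        (∀ i j, B (gM a d (GenM.f i)) (gP a d (GenP.e j)) =
            if i = j then (ss ^ d i - rr ^ d i)⁻¹ else 0) ∧
        (∀ μ ν : Fin n → ℤ,
            B (w'Pow a d μ) (wPow a d ν) = rr ^ euler a d μ ν * (ss ^ euler a d ν μ)⁻¹) ∧
        (∀ (μ : Fin n → ℤ) (i : Fin n), B (w'Pow a d μ) (gP a d (GenP.e i)) = 0) ∧
        (∀ (i : Fin n) (μ : Fin n → ℤ), B (gM a d (GenM.f i)) (wPow a d μ) = 0)) := by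
  refine ⟨exists_liftP (isPosRep_tmul hoff hsym isPosRep_gP),
    exists_liftM (isNegRep_tmul hoff hsym isNegRep_gM), ?_⟩
  rintro Δp Δm ⟨hpe, hpw, hpv⟩ ⟨hmf, hmw, hmv⟩
  obtain ⟨B, hB⟩ := exists_isSkewPairing hoff hsym hpe hpw hpv hmf hmw hmv
  refine ⟨B, ⟨hB.mul_right, hB.mul_left, hB.f_e, hB.w'Pow_wPow, hB.w'Pow_e, hB.f_wPow⟩, ?_⟩
  rintro B' ⟨h₁, h₂, h₃, h₄, h₅, h₆⟩
  exact IsSkewPairing.unique ⟨h₁, h₂, h₃, h₄, h₅, h₆⟩ hB hmf hmw hmv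

end
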